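/- Let l be a prime with l ∉ {2,3,7} and let f be a monic irreducible factor of Ĥ_{7,l}(x) in 𝔽_l[x]. Then: (i) if l ≡ 1 (mod 7), then deg f = 2; (ii) if l ≡ 6 (mod 7), then deg f ∈ {1,2}; (iii) if l ≡ 2 or 4 (mod 7), then either f(x) = x² − x + 1 or deg f = 6; (iv) if l ≡ 3 or 5 (mod 7), then either f(x) = x² − x + 1 or deg f ∈ {3,6}. -/

import Mathlib

open Polynomial

/-- The Hasse invariant `Ĥ_{7,l}(x)` of the Tate normal form `E₇` for a point of
order 7, as a polynomial over `𝔽_l = ZMod l`.  Here `n_l = ⌊l/12⌋`,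
`r = 1` iff `l ≡ 2 (mod 3)`, `s = 1` iff `l ≡ 3 (mod 4)`. -/
noncomputable def H7 (l : ℕ) : Polynomial (ZMod l) :=
  (X ^ 2 - X + 1) ^ (if l % 3 = 2 then 1 else 0) *
  (X ^ 6 - 11 * X ^ 5 + 30 * X ^ 4 - 15 * X ^ 3 - 10 * X ^ 2 + 5 * X + 1) ^
    (if l % 3 = 2 then 1 else 0) *
  (X ^ 12 - 18 * X ^ 11 + 117 * X ^ 10 - 354 * X ^ 9 + 570 * X ^ 8 - 486 * X ^ 7 +
      273 * X ^ 6 - 222 * X ^ 5 + 174 * X ^ 4 - 46 * X ^ 3 - 15 * X ^ 2 + 6 * X + 1) ^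
    (if l % 4 = 3 then 1 else 0) *
  ∑ k ∈ Finset.range (l / 12 + 1),
    (Nat.choose (2 * (l / 12) + (if l % 4 = 3 then 1 else 0))
        (2 * k + (if l % 4 = 3 then 1 else 0)) : Polynomial (ZMod l)) *
    (Nat.choose (2 * (l / 12) - 2 * k) (l / 12 - k) : Polynomial (ZMod l)) *
    (-432) ^ (l / 12 - k) *
    ((X ^ 2 - X + 1) ^ 3 *
        (X ^ 6 - 11 * X ^ 5 + 30 * X ^ 4 - 15 * X ^ 3 - 10 * X ^ 2 + 5 * X + 1) ^ 3 -
      1728 * (X ^ 7 * (X - 1) ^ 7 * (X ^ 3 - 8 * X ^ 2 + 5 * X + 1))) ^ k *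
    (X ^ 7 * (X - 1) ^ 7 * (X ^ 3 - 8 * X ^ 2 + 5 * X + 1)) ^ (l / 12 - k)

namespace WeierstrassCurve

section AddSub

variable {R : Type*} [CommRing R] (W : WeierstrassCurve R)

/-- For `u / v = x(Q)` and `x = x(P)`, the denominator of the elementary symmetric functions of
`x(Q - P)` and `x(Q + P)`. -/
def addSubDenom (u v x : R) : R := (u - x * v) ^ 2

/-- For `u / v = x(Q)` and `x = x(P)`, the numerator of `x(Q - P) + x(Q + P)`. -/
def addSubSum (u v x : R) : R :=
  2 * u * x * (u + x * v) + W.b₂ * u * x * v + W.b₄ * (u + x * v) * v + W.b₆ * v ^ 2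

/-- For `u / v = x(Q)` and `x = x(P)`, the numerator of `x(Q - P) * x(Q + P)`. -/
def addSubProd (u v x : R) : R :=
  u ^ 2 * x ^ 2 - W.b₄ * u * v * x - W.b₆ * (u + x * v) * v - W.b₈ * v ^ 2

end AddSub

namespace Affine.Point

variable {K : Type*} [Field K] [DecidableEq K] {W : WeierstrassCurve.Affine K}

/-- `(u : v)` is the image of `Q` under the `x`-coordinate map to the projective line. -/
def IsXRep (Q : W.Point) (u v : K) : Prop :=
  ∃ c ≠ 0, u = c * Q.xRep 0 ∧ v = c * Q.xRep 1

lemma addSub_xRep_of_X_ne (h1 : W.a₁ = 0) (h3 : W.a₃ = 0) {x y x' y' : K}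
    (h : W.Nonsingular x y) (h' : W.Nonsingular x' y') (hx : x' ≠ x) :
    ∃ c ≠ 0,
      addSubDenom x' 1 x = c * ((some x' y' h' - some x y h).xRep 1 *
        (some x' y' h' + some x y h).xRep 1) ∧
      W.addSubSum x' 1 x = c * ((some x' y' h' - some x y h).xRep 0 *
          (some x' y' h' + some x y h).xRep 1 +
        (some x' y' h' - some x y h).xRep 1 * (some x' y' h' + some x y h).xRep 0) ∧
      W.addSubProd x' 1 x = c * ((some x' y' h' - some x y h).xRep 0 *
        (some x' y' h' + some x y h).xRep 0) := by
  have e := (W.equation_iff x y).1 h.1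
  have e' := (W.equation_iff x' y').1 h'.1
  have hd : x' - x ≠ 0 := sub_ne_zero.2 hx
  refine ⟨(x' - x) ^ 2, pow_ne_zero 2 hd, ?_⟩
  rw [sub_eq_add_neg (some x' y' h'), neg_some, add_of_X_ne hx, add_of_X_ne hx]
  simp only [h1, h3, zero_mul, add_zero] at e e'
  simp only [xRep_some, slope_of_X_ne hx, addX, negY, h1, h3, addSubDenom, addSubSum, addSubProd,
    b₂, b₄, b₆, b₈, Matrix.cons_val_zero, Matrix.cons_val_one, Matrix.cons_val_fin_one]
  refine ⟨by ring, ?_, ?_⟩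
  · field_simp
    linear_combination (-2) * e + (-2) * e'
  · field_simp
    linear_combination
      -(y ^ 2 - y' ^ 2 + (x ^ 3 + W.a₂ * x ^ 2 + W.a₄ * x + W.a₆) -
          (x' ^ 3 + W.a₂ * x' ^ 2 + W.a₄ * x' + W.a₆) - 2 * (x' - x) ^ 2 * (W.a₂ + x + x')) * e -
      (y' ^ 2 - y ^ 2 - (x ^ 3 + W.a₂ * x ^ 2 + W.a₄ * x + W.a₆) +
          (x' ^ 3 + W.a₂ * x' ^ 2 + W.a₄ * x' + W.a₆) - 2 * (x' - x) ^ 2 * (W.a₂ + x + x')) * e'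

lemma addSub_xRep_self (h1 : W.a₁ = 0) (h3 : W.a₃ = 0) (two_ne : (2 : K) ≠ 0)
    {x y : K}
    (h : W.Nonsingular x y) :
    ∃ c ≠ 0,
      addSubDenom x 1 x = c * ((0 : W.Point).xRep 1 *
        (some x y h + some x y h).xRep 1) ∧
      W.addSubSum x 1 x = c * ((0 : W.Point).xRep 0 *
          (some x y h + some x y h).xRep 1 +
        (0 : W.Point).xRep 1 * (some x y h + some x y h).xRep 0) ∧
      W.addSubProd x 1 x = c * ((0 : W.Point).xRep 0 *
        (some x y h + some x y h).xRep 0) := by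
  have e := (W.equation_iff x y).1 h.1
  have ns := ((W.nonsingular_iff x y).1 h).2
  simp only [h1, h3, zero_mul, add_zero] at e ns
  have hn : W.negY x y = -y := by simp [negY, h1, h3]
  by_cases hy : y = W.negY x y
  · rw [add_self_of_Y_eq hy]
    rw [hn] at hy
    have hy0 : y = 0 := by
      have : 2 * y = 0 := by linear_combination hy
      exact (mul_eq_zero.1 this).resolve_left two_ne
    subst hy0
    replace ns : 3 * x ^ 2 + 2 * W.a₂ * x + W.a₄ ≠ 0 := by
      rcases ns with ns | ns
      · exact ns.symm
      · simp at ns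
    refine ⟨(3 * x ^ 2 + 2 * W.a₂ * x + W.a₄) ^ 2, pow_ne_zero 2 ns, ?_⟩
    simp only [xRep_zero, h1, h3, addSubDenom,
      addSubSum, addSubProd, b₂, b₄, b₆, b₈, Matrix.cons_val_zero, Matrix.cons_val_one,
      Matrix.cons_val_fin_one]
    refine ⟨by ring, ?_, ?_⟩
    · linear_combination (-4) * e
    · linear_combination (8 * x + 4 * W.a₂) * e
  · rw [add_self_of_Y_ne hy]
    have h2 : 2 * y ≠ 0 := fun hh => hy (by rw [hn]; linear_combination hh)
    refine ⟨(2 * y) ^ 2, pow_ne_zero 2 h2, ?_⟩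
    have hy0 : y ≠ 0 := right_ne_zero_of_mul h2
    have hyy : y - -y = 2 * y := by ring
    simp only [xRep_some, xRep_zero, slope_of_Y_ne rfl hy, addX, hn, hyy, h1, h3, addSubDenom,
      addSubSum, addSubProd, b₂, b₄, b₆, b₈, Matrix.cons_val_zero, Matrix.cons_val_one,
      Matrix.cons_val_fin_one]
    refine ⟨by ring, ?_, ?_⟩
    · linear_combination (-4) * e
    · field_simp
      linear_combination (8 * x + 4 * W.a₂) * e

end Affine.Point
end WeierstrassCurve

namespace WeierstrassCurve

namespace Affine.Point

variable {K : Type*} [Field K] [DecidableEq K] {W : WeierstrassCurve.Affine K}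

lemma addSub_xRep (h1 : W.a₁ = 0) (h3 : W.a₃ = 0) (two_ne : (2 : K) ≠ 0) (Q : W.Point)
    {x y : K} (h : W.Nonsingular x y) :
    ∃ c ≠ 0,
      addSubDenom (Q.xRep 0) (Q.xRep 1) x = c * ((Q - some x y h).xRep 1 *
        (Q + some x y h).xRep 1) ∧
      W.addSubSum (Q.xRep 0) (Q.xRep 1) x = c * ((Q - some x y h).xRep 0 *
          (Q + some x y h).xRep 1 +
        (Q - some x y h).xRep 1 * (Q + some x y h).xRep 0) ∧
      W.addSubProd (Q.xRep 0) (Q.xRep 1) x = c * ((Q - some x y h).xRep 0 *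
        (Q + some x y h).xRep 0) := by
  match Q with
  | 0 =>
    refine ⟨1, one_ne_zero, ?_⟩
    rw [zero_sub, zero_add, xRep_neg]
    simp [addSubDenom, addSubSum, addSubProd, two_mul, sq]
  | some x' y' h' =>
    by_cases hx : x' = x
    · subst hx
      rcases (X_eq_iff (h₁ := h') (h₂ := h)).1 rfl with e | e
      · rw [e, sub_self]
        simpa using addSub_xRep_self h1 h3 two_ne h
      · have e2 : -some x' y h - some x' y h = -(some x' y h + some x' y h) := by abel
        rw [e, neg_add_cancel, e2, xRep_neg, xRep_neg]
        obtain ⟨c, hc, e1, e2, e3⟩ := addSub_xRep_self h1 h3 two_ne h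
        simp only [xRep_some, Matrix.cons_val_zero, Matrix.cons_val_one, Matrix.cons_val_fin_one]
        exact ⟨c, hc, by linear_combination e1, by linear_combination e2, by linear_combination e3⟩
    · simpa using addSub_xRep_of_X_ne h1 h3 h h' hx

lemma exists_addSub_of_isXRep (h1 : W.a₁ = 0) (h3 : W.a₃ = 0) (two_ne : (2 : K) ≠ 0) {Q : W.Point}
    {x y u v : K} (h : W.Nonsingular x y) (hQ : IsXRep Q u v) :
    ∃ c ≠ 0,
      addSubDenom u v x = c * ((Q - some x y h).xRep 1 * (Q + some x y h).xRep 1) ∧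
      W.addSubSum u v x = c * ((Q - some x y h).xRep 0 * (Q + some x y h).xRep 1 +
        (Q - some x y h).xRep 1 * (Q + some x y h).xRep 0) ∧
      W.addSubProd u v x = c * ((Q - some x y h).xRep 0 * (Q + some x y h).xRep 0) := by
  obtain ⟨d, hd, rfl, rfl⟩ := hQ
  obtain ⟨c, hc, e1, e2, e3⟩ := addSub_xRep h1 h3 two_ne Q h
  refine ⟨d ^ 2 * c, mul_ne_zero (pow_ne_zero 2 hd) hc, ?_, ?_, ?_⟩
  · rw [mul_assoc, ← e1]; simp only [addSubDenom]; ring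
  · rw [mul_assoc, ← e2]; simp only [addSubSum]; ring
  · rw [mul_assoc, ← e3]; simp only [addSubProd]; ring

lemma addSub_quadratic_eq_zero (h1 : W.a₁ = 0) (h3 : W.a₃ = 0) (two_ne : (2 : K) ≠ 0)
    {Q : W.Point} {x y u v u₀ v₀ : K} (h : W.Nonsingular x y) (hQ : IsXRep Q u v)
    (hQ₀ : IsXRep (Q - some x y h) u₀ v₀) :
    u₀ ^ 2 * addSubDenom u v x - u₀ * v₀ * W.addSubSum u v x + v₀ ^ 2 * W.addSubProd u v x = 0 := by
  obtain ⟨c, hc, e1, e2, e3⟩ := exists_addSub_of_isXRep h1 h3 two_ne h hQ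
  obtain ⟨d, hd, rfl, rfl⟩ := hQ₀
  rw [e1, e2, e3]
  ring

lemma IsXRep.add (h1 : W.a₁ = 0) (h3 : W.a₃ = 0) (two_ne : (2 : K) ≠ 0)
    {Q : W.Point} {x y u v u₀ v₀ u₁ v₁ : K} (h : W.Nonsingular x y) (hQ : IsXRep Q u v)
    (hQ₀ : IsXRep (Q - some x y h) u₀ v₀) (hD : addSubDenom u v x = v₀ * v₁)
    (hS : W.addSubSum u v x = u₀ * v₁ + v₀ * u₁) (hP : W.addSubProd u v x = u₀ * u₁) :
    IsXRep (Q + some x y h) u₁ v₁ := by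
  obtain ⟨c, hc, e1, e2, e3⟩ := exists_addSub_of_isXRep h1 h3 two_ne h hQ
  obtain ⟨d, hd, rfl, rfl⟩ := hQ₀
  rw [hD] at e1
  rw [hS] at e2
  rw [hP] at e3
  have hne := (Q - some x y h).xRep_ne_zero
  generalize (Q - some x y h).xRep = r at e1 e2 e3 hne
  generalize ht : (Q + some x y h).xRep = t at e1 e2 e3
  have hor : r 0 ≠ 0 ∨ r 1 ≠ 0 := by
    by_contra! hh
    exact hne (funext fun i => by fin_cases i <;> simp [hh])
  have key : d * u₁ = c * t 0 ∧ d * v₁ = c * t 1 := by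
    rcases hor with h0 | h0
    · have hu : d * u₁ = c * t 0 := mul_left_cancel₀ h0 (by linear_combination e3)
      refine ⟨hu, mul_left_cancel₀ h0 (by linear_combination e2 - r 1 * hu)⟩
    · have hv : d * v₁ = c * t 1 := mul_left_cancel₀ h0 (by linear_combination e1)
      refine ⟨mul_left_cancel₀ h0 (by linear_combination e2 - r 0 * hv), hv⟩
  refine ⟨c / d, div_ne_zero hc hd, ?_, ?_⟩ <;> rw [ht]
  · field_simp; linear_combination key.1
  · field_simp; linear_combination key.2

end Affine.Point

section Mul

variable {K : Type*} [Field K]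

/-- The coprime polynomials `a` and `b` express multiplication by `n` on `x`-coordinates. -/
structure IsMulXRep [DecidableEq K] (W : WeierstrassCurve.Affine K) (n : ℕ) (a b : K[X]) :
    Prop where
  monic : a.Monic
  natDegree_eq : a.natDegree = n ^ 2
  degree_lt : b.degree < a.degree
  coprime : IsCoprime a b
  isXRep : ∀ x y (h : W.Nonsingular x y),
    Affine.Point.IsXRep (n • Affine.Point.some x y h) (a.eval x) (b.eval x)

variable {W : WeierstrassCurve.Affine K}

lemma exists_nonsingular [IsAlgClosed K] [W.IsElliptic] (h1 : W.a₁ = 0) (h3 : W.a₃ = 0) (x : K) :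
    ∃ y, W.Nonsingular x y := by
  obtain ⟨y, hy⟩ := IsAlgClosed.exists_pow_nat_eq (x ^ 3 + W.a₂ * x ^ 2 + W.a₄ * x + W.a₆)
    (n := 2) two_pos
  refine ⟨y, W.equation_iff_nonsingular.1 ((W.equation_iff x y).2 ?_)⟩
  simp [h1, h3, hy]

lemma addSub_ne_zero [W.IsElliptic] {u v x : K} (huv : u ≠ 0 ∨ v ≠ 0)
    (hD : addSubDenom u v x = 0) (hS : W.addSubSum u v x = 0) : W.addSubProd u v x ≠ 0 := by
  intro hP
  have hne : ![u * x, u + x * v, v] ≠ 0 := by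
    intro h
    have hv : v = 0 := congrFun h 2
    have hu : u + x * v = 0 := congrFun h 1
    simp_all
  refine W.addSubMap_ne_zero hne (funext fun i => ?_)
  fin_cases i
  · simp only [addSubProd] at hP
    simp [addSubMap]
    linear_combination hP
  · simp only [addSubSum] at hS
    simp [addSubMap]
    linear_combination hS
  · simp only [addSubDenom] at hD
    simp [addSubMap]
    linear_combination hD

end Mul

end WeierstrassCurve

namespace WeierstrassCurve

variable {K : Type*} [Field K] {W : WeierstrassCurve.Affine K}

lemma eval_addSubDenom (a b : K[X]) (x : K) :
    (addSubDenom a b X).eval x = addSubDenom (a.eval x) (b.eval x) x := by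
  simp [addSubDenom]

lemma eval_addSubSum (a b : K[X]) (x : K) :
    ((W.map C).addSubSum a b X).eval x = W.addSubSum (a.eval x) (b.eval x) x := by
  simp [addSubSum]

lemma eval_addSubProd (a b : K[X]) (x : K) :
    ((W.map C).addSubProd a b X).eval x = W.addSubProd (a.eval x) (b.eval x) x := by
  simp [addSubProd]

variable [DecidableEq K]

lemma isMulXRep_zero : IsMulXRep W 0 1 0 where
  monic := monic_one
  natDegree_eq := by simp
  degree_lt := by simp
  coprime := isCoprime_one_left
  isXRep x y h := ⟨1, one_ne_zero, by simp⟩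

lemma isMulXRep_one : IsMulXRep W 1 X 1 where
  monic := monic_X
  natDegree_eq := by simp
  degree_lt := by simp
  coprime := isCoprime_one_right
  isXRep x y h := ⟨1, one_ne_zero, by simp⟩

omit [DecidableEq K] in
lemma natDegree_X_mul_le_of_degree_lt {a b : K[X]} (hb : b.degree < a.degree) :
    (X * b).natDegree ≤ a.natDegree := by
  rcases eq_or_ne b 0 with rfl | h
  · simp
  · rw [natDegree_X_mul h]
    exact natDegree_lt_natDegree h hb

omit [DecidableEq K] in
lemma monic_addSubProd {a b : K[X]} (ha : a.Monic) (hb : b.degree < a.degree) :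
    ((W.map C).addSubProd a b X).Monic ∧
      ((W.map C).addSubProd a b X).natDegree = 2 * a.natDegree + 2 := by
  have hm : (a ^ 2 * X ^ 2).Monic := (ha.pow 2).mul (monic_X_pow 2)
  have hn : (a ^ 2 * X ^ 2).natDegree = 2 * a.natDegree + 2 := by
    rw [(ha.pow 2).natDegree_mul (monic_X_pow 2), ha.natDegree_pow, natDegree_X_pow]
  have hX := natDegree_X_mul_le_of_degree_lt hb
  have hb' : b.natDegree ≤ a.natDegree := natDegree_le_natDegree hb.le
  have e : (W.map C).addSubProd a b X = a ^ 2 * X ^ 2 +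
      (-(C W.b₄ * (a * (X * b)) + C W.b₆ * ((a + X * b) * b) + C W.b₈ * (b * b))) := by
    simp only [addSubProd, map_b₄, map_b₆, map_b₈]; ring
  have hR : (-(C W.b₄ * (a * (X * b)) + C W.b₆ * ((a + X * b) * b) +
      C W.b₈ * (b * b))).natDegree ≤ a.natDegree + a.natDegree := by
    rw [natDegree_neg]
    refine natDegree_add_le_of_degree_le (natDegree_add_le_of_degree_le ?_ ?_) ?_
    · exact (natDegree_C_mul_le _ _).trans (natDegree_mul_le_of_le le_rfl hX)
    · exact (natDegree_C_mul_le _ _).trans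
        (natDegree_mul_le_of_le (natDegree_add_le_of_degree_le le_rfl hX) hb')
    · exact (natDegree_C_mul_le _ _).trans (natDegree_mul_le_of_le hb' hb')
  have hlt : (-(C W.b₄ * (a * (X * b)) + C W.b₆ * ((a + X * b) * b) +
      C W.b₈ * (b * b))).degree < (a ^ 2 * X ^ 2).degree := by
    refine degree_lt_degree ?_
    omega
  rw [e]
  exact ⟨hm.add_of_left hlt, (natDegree_add_eq_left_of_degree_lt hlt).trans hn⟩

omit [DecidableEq K] in
lemma degree_addSubSum_lt {a b : K[X]} (hb : b.degree < a.degree) :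
    ((W.map C).addSubSum a b X).degree < (2 * a.natDegree + 2 : ℕ) := by
  have hX := natDegree_X_mul_le_of_degree_lt hb
  have hb' : b.natDegree ≤ a.natDegree := natDegree_le_natDegree hb.le
  have hXa : (X * a).natDegree ≤ 1 + a.natDegree := natDegree_mul_le_of_le natDegree_X_le le_rfl
  have e : (W.map C).addSubSum a b X = C 2 * ((X * a) * (a + X * b)) +
      C W.b₂ * (a * (X * b)) + C W.b₄ * ((a + X * b) * b) + C W.b₆ * (b * b) := by
    simp only [addSubSum, map_b₂, map_b₄, map_b₆, map_ofNat]; ring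
  have hS : ((W.map C).addSubSum a b X).natDegree ≤ 1 + a.natDegree + a.natDegree := by
    have h : ∀ {p : K[X]}, p.natDegree ≤ a.natDegree + a.natDegree →
        p.natDegree ≤ 1 + a.natDegree + a.natDegree := fun h => by omega
    have haX : (a + X * b).natDegree ≤ a.natDegree := natDegree_add_le_of_degree_le le_rfl hX
    rw [e]
    refine natDegree_add_le_of_degree_le (natDegree_add_le_of_degree_le
      (natDegree_add_le_of_degree_le ?_ (h ?_)) (h ?_)) (h ?_)
    · exact (natDegree_C_mul_le _ _).trans (natDegree_mul_le_of_le hXa haX)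
    · exact (natDegree_C_mul_le _ _).trans (natDegree_mul_le_of_le le_rfl hX)
    · exact (natDegree_C_mul_le _ _).trans (natDegree_mul_le_of_le haX hb')
    · exact (natDegree_C_mul_le _ _).trans (natDegree_mul_le_of_le hb' hb')
  exact degree_le_natDegree.trans_lt (by exact_mod_cast by omega)

lemma IsMulXRep.exists_succ [IsAlgClosed K] [W.IsElliptic] (h1 : W.a₁ = 0) (h3 : W.a₃ = 0)
    (two_ne : (2 : K) ≠ 0) {n : ℕ} {a₀ b₀ a b : K[X]} (h₀ : IsMulXRep W n a₀ b₀)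
    (h : IsMulXRep W (n + 1) a b) :
    ∃ a₁ b₁, IsMulXRep W (n + 2) a₁ b₁ ∧ addSubDenom a b X = b₀ * b₁ ∧
      (W.map C).addSubSum a b X = a₀ * b₁ + b₀ * a₁ ∧ (W.map C).addSubProd a b X = a₀ * a₁ := by
  have hsub : ∀ x y (hP : W.Nonsingular x y),
      (n + 1) • Affine.Point.some x y hP - Affine.Point.some x y hP =
        n • Affine.Point.some x y hP := fun x y hP => by
    rw [succ_nsmul, add_sub_cancel_right]
  have quad : a₀ ^ 2 * addSubDenom a b X - a₀ * b₀ * (W.map C).addSubSum a b X +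
      b₀ ^ 2 * (W.map C).addSubProd a b X = 0 := by
    refine Polynomial.funext fun x => ?_
    obtain ⟨y, hP⟩ := exists_nonsingular (W := W) h1 h3 x
    have := Affine.Point.addSub_quadratic_eq_zero h1 h3 two_ne hP (h.isXRep x y hP)
      (hsub x y hP ▸ h₀.isXRep x y hP)
    simpa [eval_addSubDenom, eval_addSubSum, eval_addSubProd] using this
  obtain ⟨a₁, ha₁⟩ : a₀ ∣ (W.map C).addSubProd a b X := by
    refine (h₀.coprime.pow_right (n := 2)).dvd_of_dvd_mul_left
      ⟨b₀ * (W.map C).addSubSum a b X - a₀ * addSubDenom a b X, ?_⟩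
    linear_combination quad
  have ha₀ := h₀.monic.ne_zero
  have quad' : a₀ * addSubDenom a b X = b₀ * ((W.map C).addSubSum a b X - b₀ * a₁) := by
    refine mul_left_cancel₀ ha₀ ?_
    linear_combination quad - b₀ ^ 2 * ha₁
  obtain ⟨b₁, hb₁⟩ : a₀ ∣ (W.map C).addSubSum a b X - b₀ * a₁ :=
    h₀.coprime.dvd_of_dvd_mul_left ⟨_, quad'.symm⟩
  have hD : addSubDenom a b X = b₀ * b₁ := mul_left_cancel₀ ha₀ (by
    linear_combination quad' + b₀ * hb₁)
  have hS : (W.map C).addSubSum a b X = a₀ * b₁ + b₀ * a₁ := by linear_combination hb₁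
  obtain ⟨hPm, hPd⟩ := monic_addSubProd (W := W) h.monic h.degree_lt
  have hm : a₁.Monic := h₀.monic.of_mul_monic_left (ha₁ ▸ hPm)
  have hd : a₁.natDegree = (n + 2) ^ 2 := by
    have := h₀.monic.natDegree_mul hm
    rw [← ha₁, hPd, h.natDegree_eq, h₀.natDegree_eq] at this
    linarith
  refine ⟨a₁, b₁, ⟨hm, hd, ?_, ?_, ?_⟩, hD, hS, ha₁⟩
  · have hs := degree_addSubSum_lt (W := W) h.degree_lt
    have e : 2 * a.natDegree + 2 = a₀.natDegree + a₁.natDegree := by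
      rw [h.natDegree_eq, h₀.natDegree_eq, hd]; ring
    have hlt : (a₀ * b₁).degree < a₀.degree + a₁.degree := by
      have : a₀ * b₁ = (W.map C).addSubSum a b X - b₀ * a₁ := hb₁.symm
      rw [this]
      refine (degree_sub_le _ _).trans_lt (max_lt ?_ ?_)
      · rw [degree_eq_natDegree ha₀, degree_eq_natDegree hm.ne_zero, ← Nat.cast_add, ← e]
        exact hs
      · rw [degree_mul]
        exact WithBot.add_lt_add_right (degree_ne_bot.2 hm.ne_zero) h₀.degree_lt
    rw [degree_mul] at hlt
    exact lt_of_add_lt_add_left hlt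
  · rw [isCoprime_iff_aeval_ne_zero_of_isAlgClosed K K]
    intro x
    by_contra! hx
    simp only [coe_aeval_eq_eval] at hx
    have hab := (isCoprime_iff_aeval_ne_zero_of_isAlgClosed K K a b).1 h.coprime x
    simp only [coe_aeval_eq_eval] at hab
    refine addSub_ne_zero (W := W) (x := x) hab ?_ ?_ ?_
    · rw [← eval_addSubDenom, hD]; simp [hx]
    · rw [← eval_addSubSum, hS]; simp [hx]
    · rw [← eval_addSubProd, ha₁]; simp [hx]
  · intro x y hP
    rw [succ_nsmul]
    refine (h.isXRep x y hP).add h1 h3 two_ne hP (hsub x y hP ▸ h₀.isXRep x y hP) ?_ ?_ ?_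
    · rw [← eval_addSubDenom, hD, eval_mul]
    · rw [← eval_addSubSum, hS]; simp
    · rw [← eval_addSubProd, ha₁, eval_mul]

lemma exists_isMulXRep [IsAlgClosed K] [W.IsElliptic] (h1 : W.a₁ = 0) (h3 : W.a₃ = 0)
    (two_ne : (2 : K) ≠ 0) (n : ℕ) : ∃ a b, IsMulXRep W n a b := by
  suffices (∃ a b, IsMulXRep W n a b) ∧ ∃ a b, IsMulXRep W (n + 1) a b from this.1
  induction n with
  | zero => exact ⟨⟨_, _, isMulXRep_zero⟩, _, _, isMulXRep_one⟩
  | succ n ih =>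
    obtain ⟨⟨a₀, b₀, h₀⟩, a, b, h⟩ := ih
    obtain ⟨a₁, b₁, h₁, -⟩ := h₀.exists_succ h1 h3 two_ne h
    exact ⟨⟨a, b, h⟩, a₁, b₁, h₁⟩

end WeierstrassCurve

namespace Polynomial

variable {K : Type*} [Field K]

lemma derivative_eq_zero_of_comp_eq_mul_sq {f g p q : K[X]} (hf : f.Separable)
    (hfg : f.natDegree = g.natDegree) (hf3 : f.natDegree = 3) (hp : 1 < p.natDegree)
    (h : f.comp p = g * q ^ 2) : derivative p = 0 := by
  by_contra hne
  have hcop : IsCoprime q ((derivative f).comp p) := by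
    have := IsCoprime.map hf (compRingHom p)
    simp only [coe_compRingHom_apply, h] at this
    exact (IsCoprime.of_mul_left_right this).of_isCoprime_of_dvd_left (dvd_pow_self q two_ne_zero)
  have hdvd : q ∣ derivative p := by
    refine hcop.dvd_of_dvd_mul_left ⟨derivative g * q + 2 * g * derivative q, ?_⟩
    have := congrArg derivative h
    rw [derivative_comp] at this
    rw [mul_comm, this, derivative_mul, derivative_sq]
    simp only [map_ofNat]
    ring
  have h1 := natDegree_le_of_dvd hdvd hne
  have h2 := natDegree_derivative_lt (p := p) (by omega)
  have hfp : f.comp p ≠ 0 := by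
    intro h0
    have := congrArg natDegree h0
    rw [natDegree_comp, natDegree_zero, hf3] at this
    omega
  have h3 := congrArg natDegree h
  rw [h] at hfp
  rw [natDegree_comp, natDegree_mul (left_ne_zero_of_mul hfp) (right_ne_zero_of_mul hfp),
    natDegree_pow, ← hfg, hf3] at h3
  omega

lemma map_frobeniusEquiv_symm_pow (p : ℕ) [Fact p.Prime] [CharP K p] [PerfectRing K p] (f : K[X]) :
    f.map (frobeniusEquiv K p).symm.toRingHom ^ p = expand K p f := by
  rw [← map_frobenius_expand, ← map_expand, map_map]
  refine Eq.trans ?_ (map_id (p := expand K p f))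
  congr 1
  ext x
  exact frobenius_apply_frobeniusEquiv_symm K p x

lemma exists_eq_pow_of_derivative_eq_zero (p : ℕ) [Fact p.Prime] [CharP K p] [PerfectRing K p]
    {f : K[X]} (h : derivative f = 0) : ∃ g, f = g ^ p :=
  ⟨_, ((map_frobeniusEquiv_symm_pow p _).trans
    (expand_contract p h (Fact.out : p.Prime).ne_zero)).symm⟩

lemma exists_comp_eq_mul_sq_of_comp_pow {p m : ℕ} [Fact p.Prime] [CharP K p] [PerfectRing K p]
    (hm : p = 2 * m + 1) {f g q z : K[X]} (hg : Squarefree g) (h0 : f.comp (z ^ p) ≠ 0)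
    (h : f.comp (z ^ p) = g * q ^ 2) :
    ∃ w, (f.map (frobeniusEquiv K p).symm.toRingHom).comp z = g * w ^ 2 := by
  set f' := f.map (frobeniusEquiv K p).symm.toRingHom with hf'
  have e : f'.comp z ^ p = f.comp (z ^ p) := by
    rw [← pow_comp, map_frobeniusEquiv_symm_pow, expand_eq_comp_X_pow, comp_assoc, X_pow_comp]
  obtain ⟨t, ht⟩ : g ∣ f'.comp z := by
    refine (hg.dvd_pow_iff_dvd (Fact.out : p.Prime).ne_zero).1 (e ▸ h ▸ dvd_mul_right g _)
  have hg0 : g ≠ 0 := hg.ne_zero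
  have ht0 : t ≠ 0 := by
    rintro rfl
    rw [← e, ht, mul_zero, zero_pow (Fact.out : p.Prime).ne_zero] at h0
    exact h0 rfl
  have hsq : (g ^ m * t ^ m) ^ 2 * t = q ^ 2 := by
    refine mul_left_cancel₀ hg0 ?_
    rw [← h, ← e, ht, hm]
    ring
  obtain ⟨w, rfl⟩ : g ^ m * t ^ m ∣ q :=
    (UniqueFactorizationMonoid.pow_dvd_pow_iff_dvd two_ne_zero).1 ⟨t, hsq.symm⟩
  refine ⟨w, ?_⟩
  rw [ht, ← mul_left_cancel₀ (pow_ne_zero 2 (mul_ne_zero (pow_ne_zero m hg0) (pow_ne_zero m ht0)))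
    (hsq.trans (mul_pow _ _ 2))]

end Polynomial

namespace WeierstrassCurve

/-- The right-hand side of the equation `y ^ 2 = x ^ 3 + a₂ * x ^ 2 + a₄ * x + a₆`. -/
noncomputable def rhs {R : Type*} [CommRing R] (W : WeierstrassCurve R) : R[X] :=
  X ^ 3 + C W.a₂ * X ^ 2 + C W.a₄ * X + C W.a₆

lemma natDegree_rhs {R : Type*} [CommRing R] [Nontrivial R] (W : WeierstrassCurve R) :
    W.rhs.natDegree = 3 := by
  unfold rhs
  compute_degree!

lemma monic_rhs {R : Type*} [CommRing R] [Nontrivial R] (W : WeierstrassCurve R) :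
    W.rhs.Monic := by
  unfold rhs
  monicity!

lemma eval_rhs {R : Type*} [CommRing R] (W : WeierstrassCurve R) (x : R) :
    W.rhs.eval x = x ^ 3 + W.a₂ * x ^ 2 + W.a₄ * x + W.a₆ := by
  simp [rhs]

lemma addSubSum_sq_sub {R : Type*} [CommRing R] (W : WeierstrassCurve R) (h1 : W.a₁ = 0)
    (h3 : W.a₃ = 0) (u v x : R) :
    W.addSubSum u v x ^ 2 - 4 * addSubDenom u v x * W.addSubProd u v x =
      16 * (x ^ 3 + W.a₂ * x ^ 2 + W.a₄ * x + W.a₆) *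
        ((u ^ 3 + W.a₂ * u ^ 2 * v + W.a₄ * u * v ^ 2 + W.a₆ * v ^ 3) * v) := by
  simp only [addSubSum, addSubDenom, addSubProd, b₂, b₄, b₆, b₈, h1, h3]
  ring

variable {K : Type*} [Field K] [IsAlgClosed K] {W : WeierstrassCurve.Affine K} [W.IsElliptic]

omit [IsAlgClosed K] in
lemma nonsingular_iff_eval_rhs (h1 : W.a₁ = 0) (h3 : W.a₃ = 0) {x y : K} :
    W.Nonsingular x y ↔ y ^ 2 = W.rhs.eval x := by
  rw [← W.equation_iff_nonsingular, W.equation_iff, eval_rhs, h1, h3]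
  simp

lemma separable_rhs (h1 : W.a₁ = 0) (h3 : W.a₃ = 0) : W.rhs.Separable := by
  rw [Separable, isCoprime_iff_aeval_ne_zero_of_isAlgClosed K K]
  intro x
  by_contra! h
  simp only [coe_aeval_eq_eval] at h
  have h0 : W.Nonsingular x 0 := (nonsingular_iff_eval_rhs h1 h3).2 (by rw [h.1]; simp)
  have h4 := h.2
  simp only [rhs, map_add, derivative_X_pow, derivative_mul, derivative_C, derivative_X,
    eval_add, eval_mul, eval_C, eval_X, eval_pow, eval_zero, eval_one] at h4
  rcases ((W.nonsingular_iff x 0).1 h0).2 with h5 | h5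
  · refine h5 ?_
    rw [h1]
    push_cast at h4
    linear_combination -h4
  · exact h5 (by simp [h1, h3])

variable [DecidableEq K]

lemma IsMulXRep.eval_ne_zero (h1 : W.a₁ = 0) (h3 : W.a₃ = 0) {n : ℕ} {a b : K[X]}
    (h : IsMulXRep W n a b) (htors : ∀ P : W.Point, n • P = 0 → P = 0) (x : K) :
    b.eval x ≠ 0 := by
  intro h0
  obtain ⟨y, hP⟩ := exists_nonsingular (W := W) h1 h3 x
  obtain ⟨c, hc, -, e⟩ := h.isXRep x y hP
  have hne := mt (htors (.some x y hP)) (Affine.Point.some_ne_zero hP)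
  rw [h0] at e
  cases hQ : n • Affine.Point.some x y hP with
  | zero => exact hne hQ
  | some x' y' h' =>
    rw [hQ] at e
    simp only [Affine.Point.xRep_some, Matrix.cons_val_one, Matrix.cons_val_fin_one, mul_one] at e
    exact hc e.symm

/-- If there is no `n`-torsion, then multiplication by `n` is polynomial on `x`-coordinates. -/
lemma exists_rhs_comp_eq_mul_sq (h1 : W.a₁ = 0) (h3 : W.a₃ = 0) (two_ne : (2 : K) ≠ 0) {n : ℕ}
    (htors : ∀ P : W.Point, (n + 1) • P = 0 → P = 0) :
    ∃ p q : K[X], p.natDegree = (n + 1) ^ 2 ∧ W.rhs.comp p = W.rhs * q ^ 2 ∧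
      ∀ x y (h : W.Nonsingular x y), ∃ y' h', (n + 1) • Affine.Point.some x y h =
        .some (p.eval x) y' h' := by
  obtain ⟨a₀, b₀, h₀⟩ := exists_isMulXRep (W := W) h1 h3 two_ne n
  obtain ⟨a, b, h⟩ := exists_isMulXRep (W := W) h1 h3 two_ne (n + 1)
  obtain ⟨a₁, b₁, -, hD, hS, hP⟩ := h₀.exists_succ h1 h3 two_ne h
  have hb := h.eval_ne_zero h1 h3 htors
  obtain ⟨β, rfl⟩ : ∃ β, b = C β := by
    refine ⟨_, eq_C_of_degree_le_zero ?_⟩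
    by_contra hdeg
    obtain ⟨x, hx⟩ := IsAlgClosed.exists_root b (fun h => hdeg h.le)
    exact hb x hx
  have hβ : β ≠ 0 := by simpa using hb 0
  set p := C β⁻¹ * a with hp
  have hcomp : W.rhs.comp p = C (β⁻¹ ^ 3) * (a ^ 3 + C W.a₂ * a ^ 2 * C β +
      C W.a₄ * a * C β ^ 2 + C W.a₆ * C β ^ 3) := by
    have hC : C β⁻¹ * C β = 1 := by rw [← C_mul, inv_mul_cancel₀ hβ, C_1]
    simp only [rhs, add_comp, mul_comp, pow_comp, X_comp, C_comp, hp, C_pow]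
    linear_combination (-C β⁻¹ ^ 2 * C W.a₂ * a ^ 2 - C β⁻¹ * C W.a₄ * a * (C β⁻¹ * C β + 1) -
      C W.a₆ * ((C β⁻¹ * C β) ^ 2 + (C β⁻¹ * C β) + 1)) * hC
  have hid := addSubSum_sq_sub (W.map C) (by simp [h1]) (by simp [h3]) a (C β) X
  rw [hD, hS, hP] at hid
  have hsq : (a₀ * b₁ - b₀ * a₁) ^ 2 = W.rhs * (C ((4 * β ^ 2) ^ 2) * W.rhs.comp p) := by
    have hC : C ((4 * β ^ 2) ^ 2) * C (β⁻¹ ^ 3) = 16 * C β := by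
      rw [← C_mul, ← map_ofNat C 16, ← C_mul]
      congr 1
      field_simp
      norm_num
    rw [hcomp]
    simp only [map_a₂, map_a₄, map_a₆] at hid
    simp only [rhs]
    linear_combination hid - (X ^ 3 + C W.a₂ * X ^ 2 + C W.a₄ * X + C W.a₆) *
      (a ^ 3 + C W.a₂ * a ^ 2 * C β + C W.a₄ * a * C β ^ 2 + C W.a₆ * C β ^ 3) * hC
  have hrhs := (monic_rhs W).ne_zero
  obtain ⟨q, hq⟩ : W.rhs ∣ a₀ * b₁ - b₀ * a₁ :=
    ((separable_rhs h1 h3).squarefree.dvd_pow_iff_dvd two_ne_zero).1 ⟨_, hsq⟩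
  have hne : 4 * β ^ 2 ≠ 0 := by
    have : (4 : K) = 2 ^ 2 := by norm_num
    rw [this]
    positivity
  refine ⟨p, C (4 * β ^ 2)⁻¹ * q, ?_, ?_, ?_⟩
  · rw [hp, natDegree_C_mul (inv_ne_zero hβ), h.natDegree_eq]
  · have hC : C ((4 * β ^ 2) ^ 2) * C (4 * β ^ 2)⁻¹ ^ 2 = 1 := by
      rw [← C_pow, ← C_mul, ← mul_pow, mul_inv_cancel₀ hne, one_pow, C_1]
    have e : C ((4 * β ^ 2) ^ 2) * W.rhs.comp p = W.rhs * q ^ 2 := by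
      refine mul_left_cancel₀ hrhs ?_
      rw [← hsq, hq]
      ring
    have hne' : (C ((4 * β ^ 2) ^ 2) : K[X]) ≠ 0 := left_ne_zero_of_mul_eq_one hC
    refine mul_left_cancel₀ hne' ?_
    linear_combination e - W.rhs * q ^ 2 * hC
  · intro x y hxy
    obtain ⟨c, hc, e1, e2⟩ := h.isXRep x y hxy
    have hne' := mt (htors (.some x y hxy)) (Affine.Point.some_ne_zero hxy)
    cases hQ : (n + 1) • Affine.Point.some x y hxy with
    | zero => exact absurd hQ hne'
    | some x' y' h' =>
      rw [hQ] at e1 e2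
      simp only [eval_C, Affine.Point.xRep_some, Matrix.cons_val_zero, Matrix.cons_val_one,
        Matrix.cons_val_fin_one, mul_one] at e1 e2
      have : p.eval x = x' := by
        rw [hp, eval_mul, eval_C, e1, e2]
        field_simp
      subst this
      exact ⟨y', h', rfl⟩

/-- In characteristic `p`, if there is no `p`-torsion, then multiplication by `p` is purely
inseparable on `x`-coordinates. -/
lemma exists_nsmul_eq_some_pow (h1 : W.a₁ = 0) (h3 : W.a₃ = 0) (two_ne : (2 : K) ≠ 0) (p : ℕ)
    [Fact p.Prime] [CharP K p] (htors : ∀ P : W.Point, p • P = 0 → P = 0) :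
    ∃ α β : K, α ≠ 0 ∧ ∀ x y (h : W.Nonsingular x y), ∃ y' h', p • Affine.Point.some x y h =
        .some (α * x ^ (p ^ 2) + β) y' h' := by
  have hp := (Fact.out : p.Prime)
  obtain ⟨n, rfl⟩ : ∃ n, p = n + 1 := ⟨p - 1, by have := hp.pos; omega⟩
  obtain ⟨m, hm⟩ : ∃ m, n + 1 = 2 * m + 1 := by
    refine (hp.eq_two_or_odd'.resolve_left ?_)
    rintro h
    exact two_ne (by simpa [h] using CharP.cast_eq_zero K (n + 1))
  have hlt := hp.one_lt
  obtain ⟨f, q, hf, hq, hmul⟩ := exists_rhs_comp_eq_mul_sq (W := W) h1 h3 two_ne htors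
  have hsep := separable_rhs (W := W) h1 h3
  obtain ⟨z, rfl⟩ := exists_eq_pow_of_derivative_eq_zero (n + 1)
    (derivative_eq_zero_of_comp_eq_mul_sq hsep rfl (natDegree_rhs W)
      (by rw [hf]; exact Nat.one_lt_pow two_ne_zero hlt) hq)
  have hz : z.natDegree = n + 1 := by
    rw [natDegree_pow] at hf
    exact mul_left_cancel₀ hp.ne_zero (hf.trans (sq _))
  obtain ⟨w, hw⟩ := exists_comp_eq_mul_sq_of_comp_pow hm hsep.squarefree (fun h0 => by
    have := congrArg natDegree h0
    rw [natDegree_comp, natDegree_rhs, hf, natDegree_zero] at this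
    have := pow_pos hp.pos 2
    omega) hq
  have hdeg : (W.rhs.map (frobeniusEquiv K (n + 1)).symm.toRingHom).natDegree = 3 :=
    (natDegree_map _).trans (natDegree_rhs W)
  obtain ⟨t, rfl⟩ := exists_eq_pow_of_derivative_eq_zero (n + 1)
    (derivative_eq_zero_of_comp_eq_mul_sq hsep.map (hdeg.trans (natDegree_rhs W).symm) hdeg
      (by rwa [hz]) hw)
  have ht : t.natDegree = 1 := by
    rw [natDegree_pow] at hz
    exact mul_left_cancel₀ hp.ne_zero (hz.trans (mul_one _).symm)
  obtain ⟨u, hu, v, rfl⟩ := natDegree_eq_one.1 ht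
  refine ⟨u ^ (n + 1) ^ 2, v ^ (n + 1) ^ 2, pow_ne_zero _ hu, fun x y h => ?_⟩
  obtain ⟨y', h', e⟩ := hmul x y h
  have e' : (((C u * X + C v : K[X]) ^ (n + 1)) ^ (n + 1)).eval x =
      u ^ (n + 1) ^ 2 * x ^ (n + 1) ^ 2 + v ^ (n + 1) ^ 2 := by
    rw [← pow_mul, ← sq]
    simp [add_pow_char_pow, mul_pow]
  simp only [e'] at h' e
  exact ⟨y', h', e⟩

end WeierstrassCurve

namespace FiniteField

variable {K : Type*} [Field K] [Fintype K]

lemma sum_pow_of_not_dvd {i : ℕ} (h : ¬ Fintype.card K - 1 ∣ i) : ∑ x : K, x ^ i = 0 := by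
  obtain ⟨g, hg⟩ := IsCyclic.exists_ofOrder_eq_natCard (α := Kˣ)
  have hg1 : (g : K) ^ i ≠ 1 := by
    intro h1
    refine h ?_
    classical rw [← Fintype.card_units, ← Nat.card_eq_fintype_card, ← hg]
    exact orderOf_dvd_of_pow_eq_one (Units.ext (by simpa using h1))
  have e : (g : K) ^ i * ∑ x : K, x ^ i = ∑ x : K, x ^ i := by
    rw [Finset.mul_sum]
    simp_rw [← mul_pow]
    exact Equiv.sum_comp (Equiv.mulLeft₀ (g : K) g.ne_zero) (fun x => x ^ i)
  have : ((g : K) ^ i - 1) * ∑ x : K, x ^ i = 0 := by rw [sub_mul, e, one_mul, sub_self]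
  exact (mul_eq_zero.1 this).resolve_left (sub_ne_zero.2 hg1)

lemma sum_eval_eq_zero {f : K[X]} (hf : f.natDegree < 2 * (Fintype.card K - 1))
    (h : f.coeff (Fintype.card K - 1) = 0) : ∑ x : K, f.eval x = 0 := by
  simp_rw [eval_eq_sum_range]
  rw [Finset.sum_comm]
  refine Finset.sum_eq_zero fun i hi => ?_
  rw [← Finset.mul_sum]
  rw [Finset.mem_range, Nat.lt_succ_iff] at hi
  by_cases hd : Fintype.card K - 1 ∣ i
  · obtain ⟨k, rfl⟩ := hd
    have hk : k < 2 := by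
      by_contra! hk
      have := Nat.mul_le_mul_left (Fintype.card K - 1) hk
      omega
    interval_cases k
    · simp
    · simp [h]
  · rw [sum_pow_of_not_dvd hd, mul_zero]

end FiniteField

namespace WeierstrassCurve

lemma Affine.natCard_point_eq {K : Type*} [Field K] [Fintype K] [DecidableEq K]
    {W : WeierstrassCurve.Affine K} [W.IsElliptic] (h1 : W.a₁ = 0) (h3 : W.a₃ = 0)
    (two_ne : ringChar K ≠ 2) :
    (Nat.card W.Point : ℤ) = 1 + ∑ x : K, (quadraticChar K (W.rhs.eval x) + 1) := by
  rw [Nat.card_congr W.nonsingularPointEquiv]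
  have e : {xy : K × K // W.Nonsingular xy.1 xy.2} ≃
      (Σ x : K, {y : K | y ^ 2 = W.rhs.eval x}.toFinset) :=
    { toFun := fun p => ⟨p.1.1, p.1.2, by simpa [nonsingular_iff_eval_rhs h1 h3] using p.2⟩
      invFun := fun p => ⟨(p.1, p.2.1), by
        simpa [nonsingular_iff_eval_rhs h1 h3] using p.2.2⟩
      left_inv := fun _ => rfl
      right_inv := fun _ => rfl }
  have e' : WithZero {xy : K × K // W.Nonsingular xy.1 xy.2} ≃
      Option (Σ x : K, {y : K | y ^ 2 = W.rhs.eval x}.toFinset) := e.optionCongr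
  rw [Nat.card_congr e', Nat.card_eq_fintype_card, Fintype.card_option, Fintype.card_sigma]
  push_cast
  rw [add_comm]
  congr 1
  refine Finset.sum_congr rfl fun x _ => ?_
  rw [Fintype.card_coe, quadraticChar_card_sqrts two_ne]

lemma Affine.eq_zero_of_nsmul_eq_zero {K : Type*} [Field K] [Finite K] [DecidableEq K]
    {W : WeierstrassCurve.Affine K} [W.IsElliptic] (h1 : W.a₁ = 0) (h3 : W.a₃ = 0) {p m : ℕ}
    [Fact p.Prime] [CharP K p] (hm : p = 2 * m + 1) {g : K[X]}
    (hg : derivative g = W.rhs ^ m) {P : W.Point} (hP : p • P = 0) : P = 0 := by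
  have := Fintype.ofFinite K
  have hp := (Fact.out : p.Prime)
  obtain ⟨n, -, hn⟩ := FiniteField.card K p
  obtain ⟨k, hk⟩ : ∃ k, (n : ℕ) = k + 1 := ⟨n - 1, by have := n.pos; omega⟩
  rw [hk] at hn
  obtain ⟨t, ht⟩ : Odd (p ^ k) := Odd.pow ⟨m, hm⟩
  have hcard : Fintype.card K = 2 * (m + p * t) + 1 := by
    rw [hn, pow_succ, ht]
    conv_lhs => rw [add_mul, one_mul]
    rw [hm]
    ring
  have hchar : ringChar K ≠ 2 := by
    rw [ringChar.eq K p]; omega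
  have hm0 : 0 < m := by have := hp.one_lt; omega
  have hderiv : derivative (g * (W.rhs ^ t) ^ p) = W.rhs ^ (m + p * t) := by
    rw [derivative_mul, hg, derivative_pow, CharP.cast_eq_zero]
    simp
    ring
  have hsum : ∑ x : K, (W.rhs.eval x) ^ (m + p * t) = 0 := by
    simp_rw [← eval_pow]
    refine FiniteField.sum_eval_eq_zero ?_ ?_
    · rw [natDegree_pow, natDegree_rhs]
      omega
    · rw [← hderiv, coeff_derivative]
      have : ((Fintype.card K - 1 : ℕ) : K) + 1 = 0 := by
        rw [hcard]
        have : ((Fintype.card K : ℕ) : K) = 0 := by simp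
        rw [hcard] at this
        simpa using this
      rw [this, mul_zero]
  have hc : (Nat.card W.Point : K) = 1 := by
    have h := congrArg (Int.cast : ℤ → K) (natCard_point_eq (W := W) h1 h3 hchar)
    push_cast at h
    rw [h]
    have h' : ∀ x : K, ((quadraticChar K (W.rhs.eval x) : ℤ) : K) =
        (W.rhs.eval x) ^ (m + p * t) := fun x => by
      rw [quadraticChar_eq_pow_of_char_ne_two' hchar]
      congr 1
      omega
    simp only [h', Finset.sum_add_distrib, hsum]
    simp
  by_contra hne
  have hord : addOrderOf P = p := addOrderOf_eq_prime hP hne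
  have hdvd : p ∣ Nat.card W.Point := hord ▸ addOrderOf_dvd_natCard P
  rw [(CharP.cast_eq_zero_iff K p _).2 hdvd] at hc
  exact zero_ne_one hc

end WeierstrassCurve

namespace Polynomial

lemma exists_derivative_eq {K : Type*} [Field K] {p : ℕ} [Fact p.Prime] [CharP K p] {f : K[X]}
    (hf : f.natDegree < 2 * p - 1) (h : f.coeff (p - 1) = 0) : ∃ g, derivative g = f := by
  have hp := (Fact.out : p.Prime).one_lt
  refine ⟨∑ i ∈ Finset.range (f.natDegree + 1), monomial (i + 1) (f.coeff i / (i + 1)), ?_⟩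
  rw [derivative_sum]
  conv_rhs => rw [f.as_sum_range]
  refine Finset.sum_congr rfl fun i hi => ?_
  rw [derivative_monomial, Nat.add_sub_cancel]
  congr 1
  by_cases hi' : i = p - 1
  · simp [hi', h]
  · push_cast
    refine div_mul_cancel₀ _ ?_
    rw [← Nat.cast_succ, Ne, CharP.cast_eq_zero_iff K p]
    rintro ⟨k, hk⟩
    rw [Finset.mem_range] at hi
    have h0 : k ≠ 0 := by rintro rfl; simp at hk
    have h1 : k ≠ 1 := by rintro rfl; omega
    have := Nat.mul_le_mul_left p (show 2 ≤ k by omega)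
    omega

lemma coeff_eq_zero_of_derivative_eq {K : Type*} [Field K] {p : ℕ} [Fact p.Prime] [CharP K p]
    {f g : K[X]} (h : derivative g = f) : f.coeff (p - 1) = 0 := by
  have hp := (Fact.out : p.Prime).pos
  rw [← h, coeff_derivative, ← Nat.cast_succ, Nat.succ_eq_add_one, Nat.sub_add_cancel hp,
    CharP.cast_eq_zero, mul_zero]

end Polynomial

namespace WeierstrassCurve

lemma rhs_map {R A : Type*} [CommRing R] [CommRing A] (W : WeierstrassCurve R) (f : R →+* A) :
    (W.map f).rhs = W.rhs.map f := by
  simp [rhs]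

namespace Affine

instance {R A : Type*} [CommRing R] [CommRing A] [Algebra R A] (W : Affine R)
    [W.IsElliptic] : (W⁄A).IsElliptic :=
  inferInstanceAs ((WeierstrassCurve.map W (algebraMap R A)).IsElliptic)

lemma eq_zero_of_nsmul_eq_zero_of_isAlgebraic {S K : Type*} [Field S] [Finite S] [Field K]
    [Algebra S K] [Algebra.IsAlgebraic S K] [DecidableEq K] {W : Affine S} [W.IsElliptic]
    (h1 : W.a₁ = 0) (h3 : W.a₃ = 0) {p m : ℕ} [Fact p.Prime] [CharP S p] (hm : p = 2 * m + 1)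
    {g : S[X]} (hg : derivative g = W.rhs ^ m) {P : (W⁄K).Point} (hP : p • P = 0) : P = 0 := by
  match P with
  | 0 => rfl
  | .some x y h =>
    set E := IntermediateField.adjoin S ({x, y} : Set K)
    have : FiniteDimensional S E := IntermediateField.finiteDimensional_adjoin fun z _ =>
      (Algebra.IsAlgebraic.isAlgebraic z).isIntegral
    have : Finite E := Module.finite_of_finite S
    have : CharP E p := charP_of_injective_algebraMap (algebraMap S E).injective p
    set x' : E := ⟨x, IntermediateField.subset_adjoin _ _ (by simp)⟩
    set y' : E := ⟨y, IntermediateField.subset_adjoin _ _ (by simp)⟩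
    have h' : (W⁄E).Nonsingular x' y' := (W.baseChange_nonsingular E.val.injective x' y').1 h
    have e : Point.map E.val (.some x' y' h' : (W⁄E).Point) = .some x y h := rfl
    rw [← e, ← map_nsmul] at hP
    have hP' : p • (.some x' y' h' : (W⁄E).Point) = 0 :=
      Point.map_injective (f := E.val) (hP.trans (map_zero _).symm)
    have hg' : derivative (g.map (algebraMap S E)) = (W⁄E).rhs ^ m := by
      rw [derivative_map, hg, Polynomial.map_pow, ← rhs_map]
      rfl
    have h1' : (W⁄E).a₁ = 0 := by simp [h1]
    have h3' : (W⁄E).a₃ = 0 := by simp [h3]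
    rw [← e, eq_zero_of_nsmul_eq_zero h1' h3' hm hg' hP', map_zero]

end Affine

end WeierstrassCurve

lemma AddMonoidHom.card_ker_comp_dvd {G : Type*} [AddCommGroup G] (f g : G →+ G)
    [Finite (f.comp g).ker] :
    Nat.card (f.comp g).ker ∣ Nat.card f.ker * Nat.card g.ker := by
  have hmem : ∀ x : (f.comp g).ker, g x ∈ f.ker := fun x => x.2
  let φ : (f.comp g).ker →+ f.ker := (g.comp (f.comp g).ker.subtype).codRestrict f.ker hmem
  have e : φ.ker ≃ g.ker :=
    { toFun := fun x => ⟨x.1.1, congrArg Subtype.val x.2⟩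
      invFun := fun x => ⟨⟨x.1, by
        have := x.2
        rw [AddMonoidHom.mem_ker] at this ⊢
        rw [AddMonoidHom.comp_apply, this, map_zero]⟩, Subtype.ext x.2⟩
      left_inv := fun _ => rfl
      right_inv := fun _ => rfl }
  rw [← φ.ker.index_mul_card, AddSubgroup.index_ker, Nat.card_congr e]
  exact mul_dvd_mul_right (AddSubgroup.card_addSubgroup_dvd_card _) _

lemma Nat.isSquare_of_sq_dvd_mul {a b q : ℕ} (hq : 7 ≤ q) (ha : 0 < a) (hb : 0 < b)
    (hadd : a + b = 2 * q + 2)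
    (hdvd : (q - 1) ^ 2 ∣ a * b) : IsSquare q := by
  obtain ⟨c, hc⟩ := hdvd
  obtain ⟨r, rfl⟩ : ∃ r, q = r + 1 := ⟨q - 1, by omega⟩
  rw [Nat.add_sub_cancel] at hc
  have hc1 : c = 1 := by
    have h0 : c ≠ 0 := by rintro rfl; simp at hc; omega
    have h2 : c < 2 := by
      by_contra! h2
      have h3 := Nat.mul_le_mul_left (r ^ 2) h2
      have h4 := four_mul_le_sq_add a b
      rw [hadd] at h4
      nlinarith
    omega
  subst hc1
  zify at hc hadd
  have hsq : ((a : ℤ) - b) ^ 2 = 4 ^ 2 * (r + 1) := by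
    linear_combination (a + b + 2 * (r + 2)) * hadd - 4 * hc
  obtain ⟨t, ht⟩ : (4 : ℤ) ∣ a - b :=
    (Int.pow_dvd_pow_iff two_ne_zero).1 ⟨_, hsq⟩
  have ht2 : t * t = r + 1 := by
    rw [ht] at hsq
    linarith
  refine ⟨t.natAbs, ?_⟩
  zify
  rw [← abs_mul, ht2, abs_of_nonneg (by positivity)]

namespace WeierstrassCurve.Affine.Point

variable {K : Type*} [Field K] [DecidableEq K] {W : Affine K}

omit [DecidableEq K] in
lemma xRep_eq_of_ne_zero {P Q : W.Point} (hP : P ≠ 0) (hQ : Q ≠ 0) (h : P.xRep 0 = Q.xRep 0) :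
    P.xRep = Q.xRep := by
  match P, Q with
  | 0, _ => exact absurd rfl hP
  | _, 0 => exact absurd rfl hQ
  | some x y h, some x' y' h' => simp_all

/-- Count the elements of a subgroup by grouping them according to their `x`-coordinates. -/
lemma natCard_eq_one_add_sum {B : AddSubgroup W.Point} {s : Finset K} {n : K → ℕ}
    (hs : ∀ Q ∈ B, Q ≠ 0 → Q.xRep 0 ∈ s)
    (hex : ∀ x ∈ s, ∃ Q : W.Point, Q ≠ 0 ∧ Q.xRep 0 = x)
    (h0 : ∀ Q : W.Point, Q ≠ 0 → Q.xRep 0 ∈ s → Q ∉ B → n (Q.xRep 0) = 0)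
    (h1 : ∀ Q ∈ B, Q ≠ 0 → Q.xRep 0 ∈ s → 2 • Q = 0 → n (Q.xRep 0) = 1)
    (h2 : ∀ Q ∈ B, Q ≠ 0 → Q.xRep 0 ∈ s → 2 • Q ≠ 0 → n (Q.xRep 0) = 2) :
    Finite B ∧ Nat.card B = 1 + ∑ x ∈ s, n x := by
  classical
  choose! R hR using hex
  let T : Finset W.Point := s.biUnion fun x => if R x ∈ B then {R x, -R x} else ∅
  have hT : ∀ Q, Q ∈ T ↔ Q ∈ B ∧ Q ≠ 0 := by
    intro Q
    simp only [T, Finset.mem_biUnion]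
    constructor
    · rintro ⟨x, hx, hQ⟩
      split_ifs at hQ with hB
      · rcases Finset.mem_insert.1 hQ with rfl | hQ
        · exact ⟨hB, (hR x hx).1⟩
        · rw [Finset.mem_singleton.1 hQ]
          exact ⟨neg_mem hB, neg_ne_zero.2 (hR x hx).1⟩
      · simp at hQ
    · rintro ⟨hB, hQ⟩
      have hx := hs Q hB hQ
      refine ⟨_, hx, ?_⟩
      have := eq_or_eq_neg_of_xRep_eq_xRep (xRep_eq_of_ne_zero hQ (hR _ hx).1 (hR _ hx).2.symm)
      have hB' : R (Q.xRep 0) ∈ B := by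
        rcases this with h | h
        · exact h ▸ hB
        · rw [h] at hB; exact neg_mem_iff.1 hB
      rw [if_pos hB']
      simpa using this
  have hins : (B : Set W.Point) = ↑(insert 0 T) := by
    ext Q
    rw [Finset.coe_insert, Set.mem_insert_iff, Finset.mem_coe, hT, SetLike.mem_coe]
    by_cases h : Q = 0
    · simp [h, B.zero_mem]
    · simp [h]
  have hfin : Finite B := by
    rw [← SetLike.coe_sort_coe, hins]
    infer_instance
  refine ⟨hfin, ?_⟩
  have hcard : Nat.card B = (insert 0 T).card := by
    rw [← SetLike.coe_sort_coe, hins]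
    simp
  rw [hcard, Finset.card_insert_of_notMem fun h => ((hT 0).1 h).2 rfl, add_comm]
  congr 1
  have hx : ∀ x, ∀ Q ∈ (if R x ∈ B then {R x, -R x} else ∅ : Finset W.Point),
      Q.xRep = (R x).xRep := by
    intro x Q hQ
    split_ifs at hQ
    · rcases Finset.mem_insert.1 hQ with rfl | hQ
      · rfl
      · rw [Finset.mem_singleton.1 hQ, xRep_neg]
    · simp at hQ
  rw [Finset.card_biUnion]
  · refine Finset.sum_congr rfl fun x hxs => ?_
    obtain ⟨hne, hx⟩ := hR x hxs
    have hxs' := hxs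
    rw [← hx] at hxs'
    by_cases hB : R x ∈ B
    · rw [if_pos hB]
      by_cases h : 2 • R x = 0
      · have hneg : -R x = R x := neg_eq_of_add_eq_zero_left ((two_nsmul _).symm.trans h)
        have e := h1 _ hB hne hxs' h
        rw [hx] at e
        rw [e, hneg]
        simp
      · have hneg : R x ≠ -R x := fun e => h (by rw [two_nsmul]; exact eq_neg_iff_add_eq_zero.1 e)
        rw [Finset.card_pair hneg, ← h2 _ hB hne hxs' h, hx]
    · rw [if_neg hB, Finset.card_empty, ← h0 _ hne hxs' hB, hx]
  · intro x hxs y hys hxy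
    refine Finset.disjoint_left.2 fun Q hQ hQ' => hxy ?_
    rw [← (hR x hxs).2, ← (hR y hys).2, ← hx x Q hQ, ← hx y Q hQ']

end WeierstrassCurve.Affine.Point

namespace WeierstrassCurve

variable {K : Type*} [Field K] [DecidableEq K] {W : Affine K}

lemma IsMulXRep.eval_eq_zero_iff {n : ℕ} {a b : K[X]} (h : IsMulXRep W n a b) {Q : W.Point}
    (hQ : Q ≠ 0) : b.eval (Q.xRep 0) = 0 ↔ n • Q = 0 := by
  match Q with
  | 0 => exact absurd rfl hQ
  | .some x y hxy =>
    obtain ⟨c, hc, -, e⟩ := h.isXRep x y hxy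
    simp only [Affine.Point.xRep_some, Matrix.cons_val_zero]
    rw [e]
    cases n • Affine.Point.some x y hxy with
    | zero =>
      change c * (0 : W.Point).xRep 1 = 0 ↔ (0 : W.Point) = 0
      simp
    | some x' y' h' => simp [hc, Affine.Point.some_ne_zero]

omit [DecidableEq K] in
lemma Affine.exists_point [IsAlgClosed K] [W.IsElliptic] (h1 : W.a₁ = 0) (h3 : W.a₃ = 0) (x : K) :
    ∃ Q : W.Point, Q ≠ 0 ∧ Q.xRep 0 = x := by
  obtain ⟨y, h⟩ := exists_nonsingular (W := W) h1 h3 x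
  exact ⟨.some x y h, Point.some_ne_zero h, by simp⟩

lemma IsMulXRep.eq_X_pow [IsAlgClosed K] [W.IsElliptic] (h1 : W.a₁ = 0) (h3 : W.a₃ = 0) {q : ℕ}
    {a b : K[X]} (h : IsMulXRep W q a b)
    (hmul : ∀ x y (h : W.Nonsingular x y), ∃ y' h',
      q • Affine.Point.some x y h = .some (x ^ q ^ 2) y' h') :
    a = X ^ q ^ 2 ∧ b = 1 := by
  have hab : ∀ x, b.eval x ≠ 0 ∧ a.eval x = b.eval x * x ^ q ^ 2 := by
    intro x
    obtain ⟨y, hxy⟩ := exists_nonsingular (W := W) h1 h3 x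
    obtain ⟨c, hc, e1, e2⟩ := h.isXRep x y hxy
    obtain ⟨y', h', e⟩ := hmul x y hxy
    rw [e] at e1 e2
    simp only [Affine.Point.xRep_some, Matrix.cons_val_zero, Matrix.cons_val_one,
      Matrix.cons_val_fin_one, mul_one] at e1 e2
    rw [e1, e2]
    exact ⟨hc, rfl⟩
  obtain ⟨β, rfl⟩ : ∃ β, b = C β := by
    refine ⟨_, eq_C_of_degree_le_zero ?_⟩
    by_contra hdeg
    obtain ⟨x, hx⟩ := IsAlgClosed.exists_root b (fun h => hdeg h.le)
    exact (hab x).1 hx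
  have ha : a = C β * X ^ q ^ 2 := Polynomial.funext fun x => by simpa using (hab x).2
  have hβ : β = 1 := by
    have := h.monic
    rw [ha] at this
    simpa using this.leadingCoeff
  subst hβ
  simpa using ha

/-- If multiplication by `q` is a purely inseparable map `x ↦ x ^ (q ^ 2)`, then the kernel of
multiplication by `q - 1` has the expected cardinality. -/
lemma Affine.natCard_eq_of_forall_mem_iff [IsAlgClosed K] [W.IsElliptic] (h1 : W.a₁ = 0)
    (h3 : W.a₃ = 0) (two_ne : (2 : K) ≠ 0) {p n : ℕ} [CharP K p] (hpq : p ∣ n + 1) (hn : n ≠ 0)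
    (hmul : ∀ x y (h : W.Nonsingular x y), ∃ y' h',
      (n + 1) • Point.some x y h = .some (x ^ (n + 1) ^ 2) y' h')
    {M : AddSubgroup W.Point} (hM : ∀ Q, Q ∈ M ↔ n • Q = 0) :
    Finite M ∧ Nat.card M = n ^ 2 := by
  obtain ⟨a₀, b₀, h₀⟩ := exists_isMulXRep (W := W) h1 h3 two_ne n
  obtain ⟨a, b, h⟩ := exists_isMulXRep (W := W) h1 h3 two_ne (n + 1)
  obtain ⟨a₁, b₁, h₁, hD, -, -⟩ := h₀.exists_succ h1 h3 two_ne h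
  obtain ⟨rfl, rfl⟩ := h.eq_X_pow h1 h3 hmul
  set s : K[X] := X ^ (n + 1) ^ 2 - X with hs
  have hs2 : s * s = b₀ * b₁ := by rw [← hD, addSubDenom, mul_one, sq]
  have hsep : s.Separable := galois_poly_separable p _ (hpq.trans (dvd_pow_self _ two_ne_zero))
  have hss : s * s ≠ 0 := mul_ne_zero hsep.ne_zero hsep.ne_zero
  have hbb : b₀ * b₁ ≠ 0 := hs2 ▸ hss
  have hb₀ := left_ne_zero_of_mul hbb
  have hb₁ := right_ne_zero_of_mul hbb
  have hmult : ∀ x, b₀.rootMultiplicity x + b₁.rootMultiplicity x = 2 * s.rootMultiplicity x := by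
    intro x
    rw [← rootMultiplicity_mul hbb, ← hs2, rootMultiplicity_mul hss, two_mul]
  have hle := rootMultiplicity_le_one_of_separable hsep
  have hdeg : b₀.natDegree + 1 = n ^ 2 := by
    have e0 := natDegree_lt_natDegree hb₀ h₀.degree_lt
    have e1 := natDegree_lt_natDegree hb₁ h₁.degree_lt
    have e := congrArg natDegree hs2
    rw [natDegree_mul hb₀ hb₁, natDegree_mul hsep.ne_zero hsep.ne_zero, hs,
      FiniteField.X_pow_card_sub_X_natDegree_eq _
        (Nat.one_lt_pow two_ne_zero (by omega))] at e
    rw [h₀.natDegree_eq] at e0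
    rw [h₁.natDegree_eq] at e1
    nlinarith
  have hpos₀ : ∀ Q : W.Point, Q ≠ 0 → (0 < b₀.rootMultiplicity (Q.xRep 0) ↔ n • Q = 0) :=
    fun Q hQ => (rootMultiplicity_pos hb₀).trans (h₀.eval_eq_zero_iff hQ)
  have hpos₁ : ∀ Q : W.Point, Q ≠ 0 → (0 < b₁.rootMultiplicity (Q.xRep 0) ↔ (n + 2) • Q = 0) :=
    fun Q hQ => (rootMultiplicity_pos hb₁).trans (h₁.eval_eq_zero_iff hQ)
  obtain ⟨hfin, hcard⟩ := Point.natCard_eq_one_add_sum (B := M) (s := b₀.roots.toFinset)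
    (n := fun x => b₀.roots.count x) (fun Q hQ hQ0 => by
      simpa [hb₀] using (h₀.eval_eq_zero_iff hQ0).2 ((hM Q).1 hQ))
    (fun x _ => exists_point h1 h3 x)
    (fun Q hQ _ hQM => by
      rw [count_roots]
      have := mt (hpos₀ Q hQ).1 (mt (hM Q).2 hQM)
      omega)
    (fun Q hQM hQ _ h2 => by
      rw [count_roots]
      have e0 := (hM Q).1 hQM
      have e1 := (hpos₀ Q hQ).2 e0
      have e2 := (hpos₁ Q hQ).2 (by rw [add_nsmul, e0, h2, add_zero])
      have := hmult (Q.xRep 0)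
      have := hle (Q.xRep 0)
      omega)
    (fun Q hQM hQ _ h2 => by
      rw [count_roots]
      have e0 := (hM Q).1 hQM
      have e1 := (hpos₀ Q hQ).2 e0
      have e2 := mt (hpos₁ Q hQ).1 (by rwa [add_nsmul, e0, zero_add])
      have := hmult (Q.xRep 0)
      have := hle (Q.xRep 0)
      omega)
  refine ⟨hfin, ?_⟩
  rw [hcard, Multiset.toFinset_sum_count_eq, IsAlgClosed.card_roots_eq_natDegree, ← hdeg, add_comm]

end WeierstrassCurve

namespace WeierstrassCurve.Affine

section

variable {K : Type*} [Field K] [DecidableEq K] {W : Affine K}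

lemma Point.natCard_add_natCard {A B : AddSubgroup W.Point} {s : Finset K}
    (hA : ∀ Q ∈ A, Q ≠ 0 → Q.xRep 0 ∈ s) (hB : ∀ Q ∈ B, Q ≠ 0 → Q.xRep 0 ∈ s)
    (hex : ∀ x ∈ s, ∃ Q : W.Point, Q ≠ 0 ∧ Q.xRep 0 = x)
    (hAB : ∀ Q : W.Point, Q ≠ 0 → Q.xRep 0 ∈ s → Q ∈ A ∨ Q ∈ B)
    (hAB2 : ∀ Q ∈ A, Q ∈ B ↔ 2 • Q = 0) (hBA2 : ∀ Q ∈ B, Q ∈ A ↔ 2 • Q = 0) :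
    0 < Nat.card A ∧ 0 < Nat.card B ∧ Nat.card A + Nat.card B = 2 * s.card + 2 := by
  classical
  choose! R hR using hex
  have hmem : ∀ C : AddSubgroup W.Point, ∀ Q : W.Point, Q ≠ 0 → Q.xRep 0 ∈ s →
      (R (Q.xRep 0) ∈ C ↔ Q ∈ C) := by
    intro C Q hQ hx
    rcases eq_or_eq_neg_of_xRep_eq_xRep
      (xRep_eq_of_ne_zero (hR _ hx).1 hQ (hR _ hx).2) with h | h
    · rw [h]
    · rw [h, neg_mem_iff]
  have key : ∀ A B : AddSubgroup W.Point, (∀ Q ∈ A, Q ≠ 0 → Q.xRep 0 ∈ s) →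
      (∀ Q ∈ A, Q ∈ B ↔ 2 • Q = 0) →
      Finite A ∧ Nat.card A = 1 + ∑ x ∈ s, if R x ∈ A then if R x ∈ B then 1 else 2 else 0 := by
    intro A B hA hAB
    refine natCard_eq_one_add_sum hA (fun x hx => ⟨R x, hR x hx⟩) ?_ ?_ ?_
    · intro Q hQ hx hQA
      rw [if_neg ((hmem A Q hQ hx).not.2 hQA)]
    · intro Q hQA hQ hx h2
      rw [if_pos ((hmem A Q hQ hx).2 hQA), if_pos ((hmem B Q hQ hx).2 ((hAB Q hQA).2 h2))]
    · intro Q hQA hQ hx h2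
      rw [if_pos ((hmem A Q hQ hx).2 hQA),
        if_neg ((hmem B Q hQ hx).not.2 ((hAB Q hQA).not.2 h2))]
  obtain ⟨hfinA, hcardA⟩ := key A B hA hAB2
  obtain ⟨hfinB, hcardB⟩ := key B A hB hBA2
  refine ⟨Nat.card_pos, Nat.card_pos, ?_⟩
  rw [hcardA, hcardB, add_add_add_comm, ← Finset.sum_add_distrib,
    Finset.sum_congr rfl (g := fun _ => 2), Finset.sum_const, smul_eq_mul, mul_comm, add_comm]
  intro x hx
  obtain ⟨h0, hxx⟩ := hR x hx
  rcases hAB (R x) h0 (by rwa [hxx]) with h | h <;> split_ifs <;> tauto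

end

variable {S K : Type*} [Field S] [Fintype S] [Field K] [Algebra S K] [DecidableEq K]
  [IsAlgClosed K] {W : Affine S} [W.IsElliptic]

/-- If the multiplication by `q` on an elliptic curve over `𝔽_q` is `x ↦ x ^ (q ^ 2)` and it fixes
a rational point that is not of order two, then `q` is a square. -/
lemma isSquare_card_of_nsmul_eq (h1 : W.a₁ = 0) (h3 : W.a₃ = 0) (two_ne : (2 : K) ≠ 0)
    {p n : ℕ} [CharP K p] (hpq : p ∣ n + 1) (hq : Fintype.card S = n + 1) (hn : 6 ≤ n)
    (hmul : ∀ x y (h : (W⁄K).Nonsingular x y), ∃ y' h',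
      (n + 1) • Point.some x y h = .some (x ^ (n + 1) ^ 2) y' h')
    {P : (W⁄K).Point} (hπ : Point.map (W' := W) (FiniteField.frobeniusAlgHom S K) P = P)
    (hP : (n + 1) • P = P) (hP2 : 2 • P ≠ 0) : IsSquare (n + 1) := by
  have h1' : (W⁄K).a₁ = 0 := by simp [h1]
  have h3' : (W⁄K).a₃ = 0 := by simp [h3]
  set π : (W⁄K).Point →+ (W⁄K).Point := Point.map (W' := W) (FiniteField.frobeniusAlgHom S K)
    with hπdef
  have hπx : ∀ Q : (W⁄K).Point, Q ≠ 0 → (π Q).xRep 0 = Q.xRep 0 ^ (n + 1) := by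
    intro Q hQ
    match Q with
    | 0 => exact absurd rfl hQ
    | .some x y h =>
      rw [hπdef, Point.map_some]
      simp [hq]
  have hπ0 : ∀ Q : (W⁄K).Point, Q ≠ 0 → π Q ≠ 0 := fun Q hQ h =>
    hQ (Point.map_injective (f := FiniteField.frobeniusAlgHom S K) (h.trans (map_zero _).symm))
  have hor : ∀ Q, (n + 1) • Q = π (π Q) ∨ (n + 1) • Q = -π (π Q) := by
    intro Q
    by_cases hQ : Q = 0
    · simp [hQ]
    · refine Point.eq_or_eq_neg_of_xRep_eq_xRep
        (Point.xRep_eq_of_ne_zero ?_ (hπ0 _ (hπ0 _ hQ)) ?_)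
      · match Q with
        | 0 => exact absurd rfl hQ
        | .some x y h =>
          obtain ⟨y', h', e⟩ := hmul x y h
          rw [e]
          exact Point.some_ne_zero _
      · rw [hπx _ (hπ0 _ hQ), hπx _ hQ, ← pow_mul, ← sq]
        match Q with
        | 0 => exact absurd rfl hQ
        | .some x y h =>
          obtain ⟨y', h', e⟩ := hmul x y h
          rw [e]
          simp
  have hpos : ∀ Q, (n + 1) • Q = π (π Q) := by
    intro Q
    by_contra hQ
    have hQ' := (hor Q).resolve_left hQ
    rcases hor (P + Q) with h | h
    · rw [nsmul_add, hP, map_add, map_add, hπ, hπ] at h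
      exact hQ (add_left_cancel h)
    · rw [nsmul_add, hP, map_add, map_add, hπ, hπ, neg_add, hQ'] at h
      refine hP2 ?_
      rw [two_nsmul]
      exact eq_neg_iff_add_eq_zero.1 (add_right_cancel h)
  set f : (W⁄K).Point →+ (W⁄K).Point := π + AddMonoidHom.id _ with hf
  set g : (W⁄K).Point →+ (W⁄K).Point := π - AddMonoidHom.id _ with hg
  have hmemf : ∀ Q, Q ∈ f.ker ↔ π Q = -Q := fun Q => by
    rw [AddMonoidHom.mem_ker, hf, AddMonoidHom.add_apply, AddMonoidHom.id_apply,
      eq_neg_iff_add_eq_zero]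
  have hmemg : ∀ Q, Q ∈ g.ker ↔ π Q = Q := fun Q => by
    rw [AddMonoidHom.mem_ker, hg, AddMonoidHom.sub_apply, AddMonoidHom.id_apply, sub_eq_zero]
  obtain ⟨hfin, hcard⟩ := natCard_eq_of_forall_mem_iff h1' h3' two_ne hpq (by omega) hmul
    (M := (f.comp g).ker) fun Q => by
      rw [AddMonoidHom.mem_ker, AddMonoidHom.comp_apply, hf, hg]
      simp only [AddMonoidHom.add_apply, AddMonoidHom.sub_apply, AddMonoidHom.id_apply, map_sub]
      rw [← hpos, add_nsmul, one_nsmul]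
      abel_nf
  have hdvd := AddMonoidHom.card_ker_comp_dvd f g
  rw [hcard] at hdvd
  set s : Finset K := (X ^ (n + 1) - X : K[X]).roots.toFinset with hs
  have hsep : (X ^ (n + 1) - X : K[X]).Separable := galois_poly_separable p _ hpq
  have hscard : s.card = n + 1 := by
    rw [hs, Multiset.toFinset_card_of_nodup (nodup_roots hsep),
      IsAlgClosed.card_roots_eq_natDegree,
      FiniteField.X_pow_card_sub_X_natDegree_eq _ (by omega)]
  have hmems : ∀ x, x ∈ s ↔ x ^ (n + 1) = x := fun x => by
    simp [hs, hsep.ne_zero, sub_eq_zero]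
  obtain ⟨hf0, hg0, hsum⟩ := Point.natCard_add_natCard (A := f.ker) (B := g.ker) (s := s)
    (fun Q hQ hQ0 => by rw [hmems, ← hπx Q hQ0, (hmemf Q).1 hQ, Point.xRep_neg])
    (fun Q hQ hQ0 => by rw [hmems, ← hπx Q hQ0, (hmemg Q).1 hQ])
    (fun x _ => exists_point h1' h3' x)
    (fun Q hQ hx => by
      rw [hmemf, hmemg, or_comm]
      rw [hmems, ← hπx Q hQ] at hx
      exact Point.eq_or_eq_neg_of_xRep_eq_xRep (Point.xRep_eq_of_ne_zero (hπ0 Q hQ) hQ hx))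
    (fun Q hQ => by
      rw [hmemf] at hQ
      rw [hmemg, hQ, neg_eq_iff_add_eq_zero, two_nsmul])
    (fun Q hQ => by
      rw [hmemg] at hQ
      rw [hmemf, hQ, eq_neg_iff_add_eq_zero, two_nsmul])
  rw [hscard] at hsum
  exact Nat.isSquare_of_sq_dvd_mul (by omega) hf0 hg0 hsum hdvd

end WeierstrassCurve.Affine

namespace WeierstrassCurve

/-- The Tate normal form for a point of order `7`, after completing the square. -/
structure IsTateSeven {F : Type*} [CommRing F] (W : WeierstrassCurve F) (d : F) : Prop where
  a₁ : W.a₁ = 0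
  a₃ : W.a₃ = 0
  a₂ : W.a₂ = (1 + d - d ^ 2) ^ 2 + 4 * (d ^ 2 - d ^ 3)
  a₄ : W.a₄ = 8 * (1 + d - d ^ 2) * (d ^ 2 - d ^ 3)
  a₆ : W.a₆ = 16 * (d ^ 2 - d ^ 3) ^ 2

namespace IsTateSeven

lemma map {F A : Type*} [CommRing F] [CommRing A] {W : WeierstrassCurve F} {d : F}
    (h : W.IsTateSeven d) (f : F →+* A) : (W.map f).IsTateSeven (f d) where
  a₁ := by simp [h.a₁]
  a₃ := by simp [h.a₃]
  a₂ := by simp [h.a₂, map_ofNat f]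
  a₄ := by simp [h.a₄, map_ofNat f]
  a₆ := by simp [h.a₆, map_ofNat f]

lemma Δ_eq {F : Type*} [CommRing F] {W : WeierstrassCurve F} {d : F} (h : W.IsTateSeven d) :
    W.Δ = 4096 * (d ^ 7 * (d - 1) ^ 7 * (d ^ 3 - 8 * d ^ 2 + 5 * d + 1)) := by
  simp only [WeierstrassCurve.Δ, b₂, b₄, b₆, b₈, h.a₁, h.a₂, h.a₃, h.a₄, h.a₆]
  ring

variable {F : Type*} [Field F] [DecidableEq F] {W : Affine F} [W.IsElliptic] {d : F}

omit [DecidableEq F] in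
lemma ne_zero (h : W.IsTateSeven d) : d ≠ 0 := by
  rintro rfl
  exact W.isUnit_Δ.ne_zero (by rw [h.Δ_eq]; simp)

omit [DecidableEq F] in
lemma ne_one (h : W.IsTateSeven d) : d - 1 ≠ 0 := by
  intro h1
  exact W.isUnit_Δ.ne_zero (by rw [h.Δ_eq, h1]; simp)

omit [DecidableEq F] in
lemma nonsingular (h : W.IsTateSeven d) {x y : F}
    (hxy : y ^ 2 = W.rhs.eval x) : W.Nonsingular x y :=
  (nonsingular_iff_eval_rhs h.a₁ h.a₃).2 hxy

lemma exists_points (h : W.IsTateSeven d) (two_ne : (2 : F) ≠ 0) :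
    ∃ h₁ h₂ h₃, 2 • Affine.Point.some (W' := W) 0 (4 * (d ^ 2 - d ^ 3)) h₁ =
        .some (4 * (d ^ 3 - d ^ 2)) (8 * ((d ^ 3 - d ^ 2) * (d ^ 2 - d)) +
          4 * (1 + d - d ^ 2) * (d ^ 3 - d ^ 2) + 4 * (d ^ 2 - d ^ 3)) h₂ ∧
      3 • Affine.Point.some (W' := W) 0 (4 * (d ^ 2 - d ^ 3)) h₁ =
        .some (4 * (d ^ 2 - d)) (8 * (d ^ 3 - 2 * d ^ 2 + d) +
          4 * (1 + d - d ^ 2) * (d ^ 2 - d) + 4 * (d ^ 2 - d ^ 3)) h₃ ∧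
      7 • Affine.Point.some (W' := W) 0 (4 * (d ^ 2 - d ^ 3)) h₁ = 0 := by
  have d0 := h.ne_zero
  have d1 := h.ne_one
  have four_ne : (4 : F) ≠ 0 := by
    rw [show (4 : F) = 2 * 2 by norm_num]
    exact mul_ne_zero two_ne two_ne
  set e := d ^ 2 - d ^ 3 with he
  have he' : e = - (d ^ 2 * (d - 1)) := by rw [he]; ring
  have e0 : e ≠ 0 := by rw [he']; exact neg_ne_zero.2 (mul_ne_zero (pow_ne_zero _ d0) d1)
  have h₁ : W.Nonsingular 0 (4 * e) := h.nonsingular (by simp [rhs, h.a₆]; ring)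
  have h₂ : W.Nonsingular (4 * (d ^ 3 - d ^ 2)) (8 * ((d ^ 3 - d ^ 2) * (d ^ 2 - d)) +
      4 * (1 + d - d ^ 2) * (d ^ 3 - d ^ 2) + 4 * (d ^ 2 - d ^ 3)) :=
    h.nonsingular (by simp [rhs, h.a₂, h.a₄, h.a₆]; ring)
  have h₃ : W.Nonsingular (4 * (d ^ 2 - d)) (8 * (d ^ 3 - 2 * d ^ 2 + d) +
      4 * (1 + d - d ^ 2) * (d ^ 2 - d) + 4 * (d ^ 2 - d ^ 3)) :=
    h.nonsingular (by simp [rhs, h.a₂, h.a₄, h.a₆]; ring)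
  have e2 : 2 • Affine.Point.some _ _ h₁ = .some _ _ h₂ := by
    have hY : 4 * e ≠ W.negY 0 (4 * e) := by
      simp only [Affine.negY, h.a₁, h.a₃]
      intro h
      have : 2 * 4 * e = 0 := by linear_combination h
      simp_all
    have hs : W.slope 0 0 (4 * e) (4 * e) = 1 + d - d ^ 2 := by
      rw [Affine.slope_of_Y_ne rfl hY, div_eq_iff (sub_ne_zero.2 hY)]
      simp only [Affine.negY, h.a₁, h.a₂, h.a₃, h.a₄]
      ring
    rw [two_nsmul, Affine.Point.add_self_of_Y_ne hY]
    simp only [Affine.Point.some.injEq, hs]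
    simp only [Affine.addX, Affine.addY, Affine.negAddY, Affine.negY, h.a₁, h.a₂, h.a₃]
    constructor <;> ring
  have e3 : 3 • Affine.Point.some _ _ h₁ = .some _ _ h₃ := by
    have hX : (0 : F) ≠ 4 * (d ^ 3 - d ^ 2) := by
      rw [show 4 * (d ^ 3 - d ^ 2) = - (4 * e) by ring]
      exact (neg_ne_zero.2 (mul_ne_zero four_ne e0)).symm
    have hs : W.slope 0 (4 * (d ^ 3 - d ^ 2)) (4 * e) (8 * ((d ^ 3 - d ^ 2) * (d ^ 2 - d)) +
        4 * (1 + d - d ^ 2) * (d ^ 3 - d ^ 2) + 4 * (d ^ 2 - d ^ 3)) =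
        2 * (d ^ 2 - d) + (1 + d - d ^ 2) := by
      rw [Affine.slope_of_X_ne hX, div_eq_iff (sub_ne_zero.2 hX)]
      ring
    rw [succ_nsmul', e2, Affine.Point.add_of_X_ne hX]
    simp only [Affine.Point.some.injEq, hs]
    simp only [Affine.addX, Affine.addY, Affine.negAddY, Affine.negY, h.a₁, h.a₂, h.a₃]
    constructor <;> ring
  have e4 : 4 • Affine.Point.some _ _ h₁ = -.some _ _ h₃ := by
    have hX : (0 : F) ≠ 4 * (d ^ 2 - d) := by
      rw [show 4 * (d ^ 2 - d) = 4 * (d * (d - 1)) by ring]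
      exact (mul_ne_zero four_ne (mul_ne_zero d0 d1)).symm
    have hs : W.slope 0 (4 * (d ^ 2 - d)) (4 * e) (8 * (d ^ 3 - 2 * d ^ 2 + d) +
        4 * (1 + d - d ^ 2) * (d ^ 2 - d) + 4 * (d ^ 2 - d ^ 3)) =
        2 * (d - 1) + (1 + d - d ^ 2) := by
      rw [Affine.slope_of_X_ne hX, div_eq_iff (sub_ne_zero.2 hX)]
      ring
    rw [succ_nsmul', e3, Affine.Point.add_of_X_ne hX, Affine.Point.neg_some]
    simp only [Affine.Point.some.injEq, hs]
    simp only [Affine.addX, Affine.addY, Affine.negAddY, Affine.negY, h.a₁, h.a₂, h.a₃]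
    constructor <;> ring
  refine ⟨h₁, h₂, h₃, e2, e3, ?_⟩
  rw [show 7 = 4 + 3 by rfl, add_nsmul, e4, e3, neg_add_cancel]

end IsTateSeven

lemma exists_pow_nsmul_eq_some_pow {K : Type*} [Field K] [IsAlgClosed K] [DecidableEq K]
    {W : Affine K} [W.IsElliptic] (h1 : W.a₁ = 0) (h3 : W.a₃ = 0) (two_ne : (2 : K) ≠ 0) (p : ℕ)
    [Fact p.Prime] [CharP K p] (htors : ∀ P : W.Point, p • P = 0 → P = 0) (j : ℕ) :
    ∃ α β : K, ∀ x y h, ∃ y' h',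
      p ^ j • Affine.Point.some (W' := W) x y h = .some (α * x ^ (p ^ j) ^ 2 + β) y' h' := by
  obtain ⟨α, β, -, H⟩ := exists_nsmul_eq_some_pow h1 h3 two_ne p htors
  induction j with
  | zero => exact ⟨1, 0, fun x y h => ⟨y, by simpa using h, by simp⟩⟩
  | succ j ih =>
    obtain ⟨α', β', H'⟩ := ih
    refine ⟨α * α' ^ p ^ 2, α * β' ^ p ^ 2 + β, fun x y h => ?_⟩
    obtain ⟨y', h', e⟩ := H' x y h
    obtain ⟨y'', h'', e'⟩ := H _ _ h'
    have hx : α * (α' * x ^ (p ^ j) ^ 2 + β') ^ p ^ 2 + β =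
        α * α' ^ p ^ 2 * x ^ (p ^ (j + 1)) ^ 2 + (α * β' ^ p ^ 2 + β) := by
      rw [add_pow_char_pow, mul_pow, ← pow_mul, ← mul_pow, ← pow_succ]
      ring
    refine ⟨y'', hx ▸ h'', ?_⟩
    have e'' : p ^ (j + 1) • Affine.Point.some x y h = p • p ^ j • Affine.Point.some x y h := by
      rw [pow_succ', mul_nsmul']
    rw [e'', e, e']
    simp only [hx]

end WeierstrassCurve

namespace WeierstrassCurve.IsTateSeven

variable {K : Type*} [Field K] [DecidableEq K] {W : Affine K} [W.IsElliptic] {d : K}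

lemma exists_xRep (h : W.IsTateSeven d) (two_ne : (2 : K) ≠ 0) :
    ∃ P : W.Point, P ≠ 0 ∧ 2 • P ≠ 0 ∧ 3 • P ≠ 0 ∧
      P.xRep 0 = 0 ∧ (2 • P).xRep 0 = 4 * (d ^ 3 - d ^ 2) ∧
      (3 • P).xRep 0 = 4 * (d ^ 2 - d) ∧
      ∀ k m, (k % 7 = m % 7 ∨ (k + m) % 7 = 0) → (k • P).xRep 0 = (m • P).xRep 0 := by
  obtain ⟨h₁, h₂, h₃, e2, e3, e7⟩ := h.exists_points two_ne
  refine ⟨_, Affine.Point.some_ne_zero h₁, e2 ▸ Affine.Point.some_ne_zero h₂,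
    e3 ▸ Affine.Point.some_ne_zero h₃, by simp, by simp [e2], by simp [e3], ?_⟩
  intro k m hkm
  rcases hkm with hkm | hkm
  · have hmod : ∀ k : ℕ, k • Affine.Point.some _ _ h₁ = (k % 7) • Affine.Point.some _ _ h₁ := by
      intro k
      conv_lhs => rw [← Nat.mod_add_div k 7, add_nsmul, mul_nsmul, e7, nsmul_zero, add_zero]
    rw [hmod k, hmod m, hkm]
  · have : (k + m) • Affine.Point.some _ _ h₁ = 0 := by
      rw [← Nat.mod_add_div (k + m) 7, hkm, zero_add, mul_nsmul, e7, nsmul_zero]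
    rw [eq_neg_of_add_eq_zero_left ((add_nsmul _ _ _).symm.trans this), Affine.Point.xRep_neg]

variable [IsAlgClosed K]

lemma pow_sq (h : W.IsTateSeven d) (two_ne : (2 : K) ≠ 0) {p : ℕ} [Fact p.Prime] [CharP K p]
    (htors : ∀ P : W.Point, p • P = 0 → P = 0) :
    (p % 7 = 1 ∨ p % 7 = 6 → d ^ p ^ 2 = d) ∧
    (p % 7 = 2 ∨ p % 7 = 5 → d ^ p ^ 2 * d = d - 1) ∧
    (p % 7 = 3 ∨ p % 7 = 4 → d ^ p ^ 2 * (d - 1) = -1) := by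
  have d0 := h.ne_zero
  have d1 := h.ne_one
  have four_ne : (4 : K) ≠ 0 := by
    rw [show (4 : K) = 2 * 2 by norm_num]
    exact mul_ne_zero two_ne two_ne
  obtain ⟨P, hP, hP2, hP3, e1, e2, e3, hmod⟩ := h.exists_xRep two_ne
  obtain ⟨α, β, -, H⟩ := exists_nsmul_eq_some_pow h.a₁ h.a₃ two_ne p htors
  have H' : ∀ Q : W.Point, Q ≠ 0 → (p • Q).xRep 0 = α * Q.xRep 0 ^ p ^ 2 + β := by
    intro Q hQ
    match Q with
    | 0 => exact absurd rfl hQ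
    | .some x y hxy =>
      obtain ⟨y', h', e⟩ := H x y hxy
      simp [e]
  have E1 := H' P hP
  have E2 := H' _ hP2
  have E3 := H' _ hP3
  rw [e1] at E1
  rw [e2, ← mul_nsmul] at E2
  rw [e3, ← mul_nsmul] at E3
  have hfrob : (4 * (d ^ 3 - d ^ 2)) ^ p ^ 2 - 0 ^ p ^ 2 =
      d ^ p ^ 2 * ((4 * (d ^ 2 - d)) ^ p ^ 2 - 0 ^ p ^ 2) := by
    rw [← sub_pow_char_pow, ← sub_pow_char_pow, ← mul_pow]
    ring
  have key : (( 2 * p) • P).xRep 0 - (p • P).xRep 0 =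
      d ^ p ^ 2 * (((3 * p) • P).xRep 0 - (p • P).xRep 0) := by
    rw [E1, E2, E3]
    linear_combination α * hfrob
  rw [← one_nsmul P] at e1
  refine ⟨fun hp => ?_, fun hp => ?_, fun hp => ?_⟩
  · rw [hmod p 1 (by omega), hmod (2 * p) 2 (by omega), hmod (3 * p) 3 (by omega), e1, e2, e3]
      at key
    refine mul_left_cancel₀ (mul_ne_zero four_ne (mul_ne_zero d0 d1)) ?_
    linear_combination -key
  · rw [hmod p 2 (by omega), hmod (2 * p) 3 (by omega), hmod (3 * p) 1 (by omega), e1, e2, e3]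
      at key
    refine mul_left_cancel₀ (mul_ne_zero four_ne (mul_ne_zero d0 d1)) ?_
    linear_combination key
  · rw [hmod p 3 (by omega), hmod (2 * p) 1 (by omega), hmod (3 * p) 2 (by omega), e1, e2, e3]
      at key
    refine mul_left_cancel₀ (mul_ne_zero four_ne (mul_ne_zero d0 d1)) ?_
    linear_combination -key

lemma nsmul_eq_some_pow (h : W.IsTateSeven d) (two_ne : (2 : K) ≠ 0) {p : ℕ} [Fact p.Prime]
    [CharP K p] (htors : ∀ P : W.Point, p • P = 0 → P = 0) {j : ℕ} (hj : p ^ j % 7 = 1)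
    (hd : d ^ p ^ j = d) (x y : K) (hxy : W.Nonsingular x y) :
    ∃ y' h', p ^ j • Affine.Point.some x y hxy = .some (x ^ (p ^ j) ^ 2) y' h' := by
  have d0 := h.ne_zero
  have d1 := h.ne_one
  have four_ne : (4 : K) ≠ 0 := by
    rw [show (4 : K) = 2 * 2 by norm_num]
    exact mul_ne_zero two_ne two_ne
  obtain ⟨P, hP, hP2, hP3, e1, e2, e3, hmod⟩ := h.exists_xRep two_ne
  obtain ⟨α, β, H⟩ := exists_pow_nsmul_eq_some_pow h.a₁ h.a₃ two_ne p htors j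
  have H' : ∀ Q : W.Point, Q ≠ 0 → (p ^ j • Q).xRep 0 = α * Q.xRep 0 ^ (p ^ j) ^ 2 + β := by
    intro Q hQ
    match Q with
    | 0 => exact absurd rfl hQ
    | .some x y hxy =>
      obtain ⟨y', h', e⟩ := H x y hxy
      simp [e]
  have E1 := H' P hP
  have E2 := H' _ hP2
  have hp : p ≠ 0 := (Fact.out : p.Prime).ne_zero
  have hx : (4 * (d ^ 3 - d ^ 2)) ^ p ^ j = 4 * (d ^ 3 - d ^ 2) := by
    have h4 : (4 : K) ^ p ^ j = 4 := by
      have := map_natCast (iterateFrobenius K p j) 4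
      simpa [iterateFrobenius_def] using this
    rw [mul_pow, sub_pow_char_pow, ← pow_mul, ← pow_mul, mul_comm 3, mul_comm 2, pow_mul, pow_mul,
      hd, h4]
  rw [hmod _ 1 (by omega), one_nsmul, e1, zero_pow (by positivity), mul_zero, zero_add] at E1
  rw [← mul_nsmul, hmod _ 2 (by omega), e2, ← E1, add_zero, sq (p ^ j), pow_mul, hx, hx] at E2
  have hα : α = 1 := by
    refine mul_right_cancel₀ (b := 4 * (d ^ 3 - d ^ 2)) ?_ (by rw [← E2, one_mul])
    rw [show d ^ 3 - d ^ 2 = d * d * (d - 1) by ring]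
    exact mul_ne_zero four_ne (mul_ne_zero (mul_ne_zero d0 d0) d1)
  subst hα E1
  simpa using H x y hxy

end WeierstrassCurve.IsTateSeven

namespace WeierstrassCurve.Affine

lemma isSquare_card_of_isTateSeven {S : Type*} [Field S] [Fintype S] {W : Affine S}
    [W.IsElliptic] {d : S}
    (h : W.IsTateSeven d) {p m j : ℕ} [Fact p.Prime] [CharP S p] (hm : p = 2 * m + 1)
    {g : S[X]} (hg : derivative g = W.rhs ^ m) (hS : Fintype.card S = p ^ j)
    (hj : p ^ j % 7 = 1) : IsSquare (p ^ j) := by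
  classical
  set K := AlgebraicClosure S
  have : CharP K p := charP_of_injective_algebraMap (algebraMap S K).injective p
  have htors : ∀ P : (W⁄K).Point, p • P = 0 → P = 0 := fun P hP =>
    Affine.eq_zero_of_nsmul_eq_zero_of_isAlgebraic h.a₁ h.a₃ hm hg hP
  have two_ne : (2 : K) ≠ 0 := Ring.two_ne_zero (by
    rw [ringChar.eq K p]
    omega)
  have hK : (W⁄K).IsTateSeven (algebraMap S K d) := h.map _
  have hfrob : ∀ x : S, algebraMap S K x ^ p ^ j = algebraMap S K x := fun x => by
    rw [← map_pow, ← hS, FiniteField.pow_card]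
  obtain ⟨n, hn⟩ : ∃ n, p ^ j = n + 1 := ⟨p ^ j - 1, by omega⟩
  have h1n : 1 < p ^ j := hS ▸ Fintype.one_lt_card
  have hj0 : j ≠ 0 := by
    rintro rfl
    simp at h1n
  obtain ⟨h₁, h₂, h₃, e2, e3, e7⟩ := hK.exists_points two_ne
  have hmul := hK.nsmul_eq_some_pow two_ne htors hj (hfrob d)
  rw [hn] at hmul hS ⊢
  refine Affine.isSquare_card_of_nsmul_eq h.a₁ h.a₃ two_ne (p := p) (hn ▸ dvd_pow_self p hj0) hS
    (by omega) hmul (P := .some _ _ h₁) ?_ ?_ (e2 ▸ Affine.Point.some_ne_zero _)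
  · rw [Affine.Point.map_some]
    simp only [Affine.Point.some.injEq, FiniteField.coe_frobeniusAlgHom, hS, ← hn]
    have := hfrob (4 * (d ^ 2 - d ^ 3))
    simp only [map_mul, map_sub, map_pow, map_ofNat] at this
    refine ⟨zero_pow (by omega), this⟩
  · rw [← hn, ← Nat.mod_add_div (p ^ j) 7, hj, add_nsmul, mul_nsmul, e7, nsmul_zero, add_zero,
      one_nsmul]

end WeierstrassCurve.Affine

namespace Polynomial

variable {R : Type*} [CommRing R]

lemma coeff_cubic_pow (a b : R) (m : ℕ) :
    ((X ^ 3 + C a * X ^ 2 + C b) ^ m).coeff (2 * m) =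
      ∑ k ∈ Finset.range (m + 1),
        m.choose k * (m - k).choose (2 * k) * a ^ (m - 3 * k) * b ^ k := by
  rw [show X ^ 3 + C a * X ^ 2 + C b = C b + X ^ 2 * (X + C a) by ring, add_pow, finsetSum_coeff]
  refine Finset.sum_congr rfl fun k hk => ?_
  rw [Finset.mem_range] at hk
  rw [coeff_mul_natCast, ← C_pow, coeff_C_mul, mul_pow, ← pow_mul, coeff_X_pow_mul',
    if_pos (by omega), show 2 * m - 2 * (m - k) = 2 * k by omega, coeff_X_add_C_pow,
    show m - k - 2 * k = m - 3 * k by omega]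
  ring

lemma coeff_mul_linear_pow (u v : R) (N : ℕ) :
    (((X + C u) * (X + C u + C v)) ^ N).coeff N =
      ∑ k ∈ Finset.range (N + 1), N.choose k * (N + k).choose k * u ^ k * v ^ (N - k) := by
  rw [mul_pow, add_pow (X + C u), Finset.mul_sum, finsetSum_coeff]
  refine Finset.sum_congr rfl fun k _ => ?_
  rw [← mul_assoc, ← mul_assoc, ← pow_add, coeff_mul_natCast, ← C_pow, coeff_mul_C,
    coeff_X_add_C_pow, Nat.add_sub_cancel_left, Nat.choose_symm_add]
  ring

lemma coeff_quadratic_pow (c e : R) (n : ℕ) {s : ℕ} (hs : s ≤ 1) :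
    ((X ^ 2 + C c * X + C e) ^ (2 * n + s)).coeff (2 * n + s) =
      ∑ k ∈ Finset.range (n + 1), (2 * n + s).choose (2 * k + s) *
        (2 * n - 2 * k).choose (n - k) * c ^ (2 * k + s) * e ^ (n - k) := by
  rw [show X ^ 2 + C c * X + C e = C c * X + (X ^ 2 + C e) by ring, add_pow, finsetSum_coeff]
  have hexp : ∀ j, (X ^ 2 + C e) ^ j = expand R 2 ((X + C e) ^ j) := fun j => by simp
  have hterm : ∀ j ∈ Finset.range (2 * n + s + 1),
      (((C c * X) ^ j * (X ^ 2 + C e) ^ (2 * n + s - j) *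
      ((2 * n + s).choose j : R[X])).coeff (2 * n + s)) =
      if 2 ∣ 2 * n + s - j then (2 * n + s).choose j *
        (2 * n + s - j).choose ((2 * n + s - j) / 2) * c ^ j *
          e ^ (2 * n + s - j - (2 * n + s - j) / 2) else 0 := by
    intro j hj
    rw [Finset.mem_range] at hj
    rw [coeff_mul_natCast, mul_pow, ← C_pow, mul_assoc, coeff_C_mul, coeff_X_pow_mul',
      if_pos (by omega), hexp, coeff_expand two_pos]
    split_ifs
    · rw [coeff_X_add_C_pow]
      ring
    · simp
  rw [Finset.sum_congr rfl hterm, ← Finset.sum_filter]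
  symm
  refine Finset.sum_nbij' (fun k => 2 * k + s) (fun j => j / 2) ?_ ?_ ?_ ?_ ?_
  · intro k hk
    simp only [Finset.mem_range, Finset.mem_filter] at hk ⊢
    omega
  · intro k hk
    simp only [Finset.mem_range, Finset.mem_filter] at hk ⊢
    omega
  · intro k hk
    omega
  · intro k hk
    simp only [Finset.mem_range, Finset.mem_filter] at hk
    omega
  · intro k hk
    rw [show 2 * n + s - (2 * k + s) = 2 * n - 2 * k by omega,
      show (2 * n - 2 * k) / 2 = n - k by omega, show 2 * n - 2 * k - (n - k) = n - k by omega]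

end Polynomial

lemma Nat.choose_mul_choose_succ (k t : ℕ) :
    (3 * k + 3 + t).choose (k + 1) * (2 * k + 2 + t).choose (2 * k + 2) *
        ((k + 1) * (2 * k + 1) * (2 * k + 2)) =
      (3 * k + 3 + t).choose k * (2 * k + 3 + t).choose (2 * k) *
        ((t + 1) * (t + 2) * (t + 3)) := by
  have e1 := Nat.choose_succ_right_eq (3 * k + 3 + t) k
  have e2 := Nat.choose_succ_right_eq (2 * k + 2 + t) (2 * k + 1)
  have e3 := Nat.choose_succ_right_eq (2 * k + 2 + t) (2 * k)
  have e4 := Nat.choose_mul_succ_eq (2 * k + 2 + t) (2 * k)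
  rw [show 3 * k + 3 + t - k = 2 * k + 3 + t by omega] at e1
  rw [show 2 * k + 2 + t - (2 * k + 1) = t + 1 by omega] at e2
  rw [show 2 * k + 2 + t - 2 * k = t + 2 by omega] at e3
  rw [show 2 * k + 2 + t + 1 = 2 * k + 3 + t by omega,
    show 2 * k + 3 + t - 2 * k = t + 3 by omega] at e4
  zify at *
  linear_combination (2 * k + 2 + t).choose (2 * k + 2) * (2 * k + 1) * (2 * k + 2) * e1 +
    (3 * k + 3 + t).choose k * (2 * k + 3 + t) * (2 * k + 1) * e2 +
    (3 * k + 3 + t).choose k * (2 * k + 3 + t) * (t + 1) * e3 +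
    (3 * k + 3 + t).choose k * (t + 1) * (t + 2) * e4

lemma Nat.choose_mul_choose_add_succ (k t : ℕ) :
    (k + 1 + t).choose (k + 1) * (k + 1 + t + (k + 1)).choose (k + 1) * (k + 1) ^ 2 =
      (k + 1 + t).choose k * (k + 1 + t + k).choose k * ((t + 1) * (2 * k + 2 + t)) := by
  have e1 := Nat.choose_succ_right_eq (k + 1 + t) k
  have e2 := Nat.add_one_mul_choose_eq (k + 1 + t + k) k
  rw [show k + 1 + t - k = t + 1 by omega] at e1
  rw [show k + 1 + t + k + 1 = k + 1 + t + (k + 1) by omega] at e2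
  zify at *
  linear_combination (k + 1 + t + (k + 1)).choose (k + 1) * (k + 1) * e1 -
    (k + 1 + t).choose k * (t + 1) * e2

/-- The trinomial coefficients `m! / (k! (2 k)! (m - 3 k)!)` with `m = (p - 1) / 2` reduce modulo
`p` to the coefficients of a Legendre polynomial. -/
lemma CharP.choose_mul_choose_mul_pow {K : Type*} [Field K] {p m N r : ℕ} [Fact p.Prime] [CharP K p]
    (hm : p = 2 * m + 1) (hN : m = 3 * N + 2 * r) (hr : r ≤ 1) {k : ℕ} (hk : k ≤ N) :
    (m.choose k * (m - k).choose (2 * k) : K) * 4 ^ k =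
      27 ^ k * (N.choose k * (N + k).choose k) := by
  have hp : (2 * (m : K) + 1) = 0 := by
    have := CharP.cast_eq_zero K p
    rw [hm] at this
    exact_mod_cast this
  induction k with
  | zero => simp
  | succ k ih =>
    specialize ih (by omega)
    obtain ⟨t, ht⟩ : ∃ t, m = 3 * k + 3 + t := ⟨m - (3 * k + 3), by omega⟩
    obtain ⟨t', ht'⟩ : ∃ t', N = k + 1 + t' := ⟨N - (k + 1), by omega⟩
    have e1 := congrArg (Nat.cast (R := K)) (Nat.choose_mul_choose_succ k t)
    have e2 := congrArg (Nat.cast (R := K)) (Nat.choose_mul_choose_add_succ k t')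
    rw [show 3 * k + 3 + t = m by omega, show 2 * k + 2 + t = m - (k + 1) by omega,
      show 2 * k + 3 + t = m - k by omega] at e1
    rw [show k + 1 + t' = N by omega] at e2
    have hm' : (m : K) = 3 * k + 3 + t := by rw [ht]; push_cast; ring
    have hN' : (m : K) = 3 * (k + 1 + t') + 2 * r := by rw [hN, ht']; push_cast; ring
    have hne : ∀ j : ℕ, 0 < j → j < p → (j : K) ≠ 0 := fun j h0 hj h => by
      rw [CharP.cast_eq_zero_iff K p] at h
      exact absurd (Nat.le_of_dvd h0 h) (by omega)
    have h1 := hne (k + 1) (by omega) (by omega)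
    have h2 := hne (2 * k + 1) (by omega) (by omega)
    have h3 := hne 2 (by omega) (by omega)
    push_cast at e1 e2 h1 h2 h3 ⊢
    refine mul_right_cancel₀
      (mul_ne_zero (mul_ne_zero (mul_ne_zero h1 h1) h2) (pow_ne_zero 2 h3)) ?_
    have a1 : 2 * ((t : K) + 1) = -(6 * k + 5) := by linear_combination hp - 2 * hm'
    have a2 : 2 * ((t : K) + 2) = -(6 * k + 3) := by linear_combination hp - 2 * hm'
    have a3 : 2 * ((t : K) + 3) = -(6 * k + 1) := by linear_combination hp - 2 * hm'
    have b1 : 6 * ((t' : K) + 1) = -(6 * k + 1 + 4 * r) := by linear_combination hp - 2 * hN'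
    have b2 : 6 * (2 * k + 2 + (t' : K)) = 6 * k + 5 - 4 * r := by linear_combination hp - 2 * hN'
    have ha : 8 * (((t : K) + 1) * (t + 2) * (t + 3)) =
        -((6 * k + 5) * (6 * k + 3) * (6 * k + 1)) := by
      linear_combination 2 * ((t : K) + 2) * (2 * (t + 3)) * a1 - (6 * k + 5) * (2 * (t + 3)) * a2 +
        (6 * k + 5) * (6 * k + 3) * a3
    have hb : 36 * (((t' : K) + 1) * (2 * k + 2 + t')) = -((6 * k + 5) * (6 * k + 1)) := by
      have : (r : K) * (r - 1) = 0 := by interval_cases r <;> simp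
      linear_combination 6 * (2 * k + 2 + (t' : K)) * b1 - (6 * k + 1 + 4 * r) * b2 + 16 * this
    linear_combination 2 * 4 ^ (k + 1) * e1 - 27 ^ (k + 1) * (2 * k + 1) * 4 * e2 +
      8 * ((t : K) + 1) * (t + 2) * (t + 3) * ih + 27 ^ k * (N.choose k * (N + k).choose k) * ha -
      27 ^ k * 3 * (2 * k + 1) * (N.choose k * (N + k).choose k) * hb

lemma Polynomial.coeff_cubic_pow_eq {K : Type*} [Field K] {p m N r : ℕ} [Fact p.Prime] [CharP K p]
    (hm : p = 2 * m + 1) (hN : m = 3 * N + 2 * r) (hr : r ≤ 1) (w u : K) :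
    ((X ^ 3 + C (3 * w) * X ^ 2 + C (4 * u)) ^ m).coeff (2 * m) =
      27 ^ N * (9 * w ^ 2) ^ r * (((X + C u) * (X + C u + C (w ^ 3))) ^ N).coeff N := by
  rw [coeff_cubic_pow, coeff_mul_linear_pow, Finset.mul_sum]
  have hsub : Finset.range (N + 1) ⊆ Finset.range (m + 1) :=
    Finset.range_subset_range.2 (by omega)
  rw [← Finset.sum_subset hsub]
  · refine Finset.sum_congr rfl fun k hk => ?_
    rw [Finset.mem_range, Nat.lt_succ_iff] at hk
    have h := CharP.choose_mul_choose_mul_pow (K := K) hm hN hr hk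
    obtain ⟨t, rfl⟩ := Nat.exists_eq_add_of_le hk
    rw [show m - 3 * k = 3 * t + 2 * r by omega, Nat.add_sub_cancel_left]
    rw [mul_pow, pow_add w, pow_add (3 : K), pow_mul, pow_mul, pow_mul, mul_pow, mul_pow]
    norm_num
    rw [pow_add]
    linear_combination 27 ^ t * 9 ^ r * (w ^ 3) ^ t * (w ^ 2) ^ r * u ^ k * h
  · intro k hk hk'
    rw [Finset.mem_range] at hk hk'
    rw [Nat.choose_eq_zero_of_lt (show m - k < 2 * k by omega)]
    simp

namespace TateSeven

variable {R : Type*} [CommRing R]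

/-- The invariant `c₄` of the Tate normal form for a point of order `7`. -/
def c₄ (d : R) : R :=
  (d ^ 2 - d + 1) * (d ^ 6 - 11 * d ^ 5 + 30 * d ^ 4 - 15 * d ^ 3 - 10 * d ^ 2 + 5 * d + 1)

/-- The invariant `-c₆` of the Tate normal form for a point of order `7`. -/
def negC₆ (d : R) : R :=
  d ^ 12 - 18 * d ^ 11 + 117 * d ^ 10 - 354 * d ^ 9 + 570 * d ^ 8 - 486 * d ^ 7 +
    273 * d ^ 6 - 222 * d ^ 5 + 174 * d ^ 4 - 46 * d ^ 3 - 15 * d ^ 2 + 6 * d + 1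

/-- The discriminant of the Tate normal form for a point of order `7`. -/
def Δ (d : R) : R :=
  d ^ 7 * (d - 1) ^ 7 * (d ^ 3 - 8 * d ^ 2 + 5 * d + 1)

lemma c₄_cube_sub (d : R) : c₄ d ^ 3 - 1728 * Δ d = negC₆ d ^ 2 := by
  simp only [c₄, negC₆, Δ]
  ring

lemma map_c₄ {A : Type*} [CommRing A] (f : R →+* A) (d : R) : f (c₄ d) = c₄ (f d) := by
  simp [c₄, map_ofNat f]

lemma map_negC₆ {A : Type*} [CommRing A] (f : R →+* A) (d : R) : f (negC₆ d) = negC₆ (f d) := by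
  simp [negC₆, map_ofNat f]

lemma map_Δ {A : Type*} [CommRing A] (f : R →+* A) (d : R) : f (Δ d) = Δ (f d) := by
  simp [Δ, map_ofNat f]

/-- The polynomial `(X ^ 2 - c₆ X - 432 Δ) ^ N`, whose middle coefficient is a Hasse invariant. -/
noncomputable def hassePoly (d : R) (N : ℕ) : R[X] :=
  (X ^ 2 + C (negC₆ d) * X + C (-432 * Δ d)) ^ N

lemma aeval_H7 (l : ℕ) [Algebra (ZMod l) R] (d : R) :
    aeval d (H7 l) = c₄ d ^ (if l % 3 = 2 then 1 else 0) *
      (hassePoly d (2 * (l / 12) + if l % 4 = 3 then 1 else 0)).coeff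
        (2 * (l / 12) + if l % 4 = 3 then 1 else 0) := by
  have hs : (if l % 4 = 3 then 1 else 0) ≤ 1 := by split_ifs <;> simp
  simp only [H7, hassePoly]
  generalize (if l % 4 = 3 then 1 else 0) = s at hs ⊢
  rw [coeff_quadratic_pow _ _ _ hs]
  simp only [map_mul, map_pow, map_sub, map_add, map_sum, aeval_X, map_one, map_ofNat, map_neg,
    map_natCast]
  rw [← mul_pow, mul_assoc, Finset.mul_sum]
  refine congrArg _ (Finset.sum_congr rfl fun k _ => ?_)
  have := c₄_cube_sub d
  simp only [c₄, Δ, mul_pow] at this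
  simp only [Δ]
  rw [mul_pow (-432), pow_add, pow_mul, ← negC₆, this]
  ring

lemma c₄_ne_zero_of_Δ_eq_zero {K : Type*} [Field K] (h7 : (7 : K) ≠ 0) {d : K} (hΔ : Δ d = 0) :
    c₄ d ≠ 0 := by
  intro h
  simp only [Δ, mul_eq_zero, pow_eq_zero_iff (show 7 ≠ 0 by norm_num)] at hΔ
  rcases hΔ with (rfl | hΔ) | hΔ
  · simp [c₄] at h
  · obtain rfl := sub_eq_zero.1 hΔ
    simp only [c₄] at h
    norm_num at h
  · refine pow_ne_zero 2 h7 ?_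
    simp only [c₄] at h
    linear_combination (-444 * d ^ 2 + 3005 * d + 1710) * h + (444 * d ^ 7 - 4781 * d ^ 6 +
      12530 * d ^ 5 - 6853 * d ^ 4 - 693 * d ^ 3 + 6776 * d ^ 2 - 1540 * d - 1661) * hΔ

lemma Δ_ne_zero {K : Type*} [Field K] (h7 : (7 : K) ≠ 0) {d : K} {r N : ℕ}
    (h : c₄ d ^ r * (hassePoly d N).coeff N = 0) : Δ d ≠ 0 := by
  intro hΔ
  have h4 := c₄_ne_zero_of_Δ_eq_zero h7 hΔ
  have h6 : negC₆ d ≠ 0 := by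
    intro h6
    have := c₄_cube_sub d
    rw [hΔ, h6] at this
    simp [h4] at this
  rw [hassePoly, hΔ, mul_zero, C_0, add_zero, sq, ← add_mul, mul_pow, coeff_mul_X_pow'] at h
  simp [h4, h6, coeff_zero_eq_eval_zero] at h

lemma coeff_hassePoly_ne_zero {K : Type*} [Field K] {p : ℕ} [Fact p.Prime] [CharP K p] {d : K}
    (h4 : c₄ d = 0) {N : ℕ} (hN : 2 * N < p) (hp : 2 < p) (h6 : negC₆ d ≠ 0) :
    (hassePoly d N).coeff N ≠ 0 := by
  have hne : ∀ j : ℕ, 0 < j → j < p → (j : K) ≠ 0 := fun j h0 hj h => by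
    rw [CharP.cast_eq_zero_iff K p] at h
    exact absurd (Nat.le_of_dvd h0 h) (by omega)
  have h2 : (2 : K) ≠ 0 := by exact_mod_cast hne 2 two_pos hp
  obtain ⟨v, hv⟩ : ∃ v, negC₆ d = 2 * v := ⟨negC₆ d / 2, by field_simp⟩
  have hΔ : -432 * Δ d = v ^ 2 := by
    have := c₄_cube_sub d
    rw [h4, hv] at this
    refine mul_left_cancel₀ (mul_ne_zero h2 h2) ?_
    linear_combination this
  have e : hassePoly d N = (X + C v) ^ (2 * N) := by
    rw [hassePoly, hΔ, hv, pow_mul]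
    simp only [map_mul, map_pow, map_ofNat]
    ring
  rw [e, coeff_X_add_C_pow]
  refine mul_ne_zero (pow_ne_zero _ (right_ne_zero_of_mul (hv ▸ h6))) ?_
  rw [Ne, CharP.cast_eq_zero_iff K p]
  intro h
  have hdvd : (2 * N).choose N ∣ (2 * N).factorial := by
    rw [← Nat.choose_mul_factorial_mul_factorial (show N ≤ 2 * N by omega), mul_assoc]
    exact dvd_mul_right _ _
  exact absurd ((Fact.out : p.Prime).dvd_factorial.1 (h.trans hdvd)) (by omega)

end TateSeven

namespace Polynomial

lemma coeff_pow_eq_zero_of_comp {K : Type*} [Field K] {p m : ℕ} [Fact p.Prime] [CharP K p]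
    (hm : p = 2 * m + 1) {f h : K[X]} {a b c : K} (ha : a ≠ 0) (hc : c ≠ 0) (hh : h.natDegree ≤ 3)
    (e : C c * f = h.comp (C a * X + C b)) (h0 : (h ^ m).coeff (2 * m) = 0) :
    (f ^ m).coeff (2 * m) = 0 := by
  have hp : p - 1 = 2 * m := by omega
  have hdeg : (h ^ m).natDegree < 2 * p - 1 :=
    natDegree_pow_le.trans_lt (by
      nlinarith [Nat.mul_le_mul_left m hh, (show 2 * p - 1 = 4 * m + 1 by omega)])
  obtain ⟨g, hg⟩ := exists_derivative_eq hdeg (by rwa [hp])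
  rw [← hp]
  refine coeff_eq_zero_of_derivative_eq (g := C (c ^ m * a)⁻¹ * g.comp (C a * X + C b)) ?_
  have hca : c ^ m * a ≠ 0 := mul_ne_zero (pow_ne_zero _ hc) ha
  rw [derivative_C_mul, derivative_comp, hg, pow_comp, ← e]
  have hd : derivative (C a * X + C b) = C a := by simp
  rw [hd, mul_pow, ← C_pow]
  calc C (c ^ m * a)⁻¹ * (C a * (C (c ^ m) * f ^ m)) =
      C ((c ^ m * a)⁻¹ * (c ^ m * a)) * f ^ m := by simp only [C_mul]; ring
    _ = f ^ m := by rw [inv_mul_cancel₀ hca, C_1, one_mul]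

end Polynomial

namespace TateSeven

lemma coeff_rhs_pow_eq_zero {K : Type*} [Field K] [IsAlgClosed K] {p m N r : ℕ} [Fact p.Prime]
    [CharP K p] (hm : p = 2 * m + 1) (hN : m = 3 * N + 2 * r) (hr : r ≤ 1) (two_ne : (2 : K) ≠ 0)
    (three_ne : (3 : K) ≠ 0) {W : WeierstrassCurve K} {d : K} (hW : W.IsTateSeven d)
    (h : c₄ d ^ r * (hassePoly d N).coeff N = 0) : (W.rhs ^ m).coeff (2 * m) = 0 := by
  obtain ⟨w, hw⟩ := IsAlgClosed.exists_pow_nat_eq (c₄ d) two_pos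
  obtain ⟨u, hu⟩ : ∃ u, negC₆ d = 2 * u + w ^ 3 := ⟨(negC₆ d - w ^ 3) / 2, by field_simp; ring⟩
  have hpoly : hassePoly d N = ((X + C u) * (X + C u + C (w ^ 3))) ^ N := by
    have e : -432 * Δ d = u * (u + w ^ 3) := by
      have := c₄_cube_sub d
      rw [← hw, hu] at this
      refine mul_left_cancel₀ (mul_ne_zero two_ne two_ne) ?_
      linear_combination this
    rw [hassePoly, e, hu]
    simp only [map_mul, map_pow, map_add, map_ofNat]
    ring
  refine coeff_pow_eq_zero_of_comp hm (h := X ^ 3 + C (3 * w) * X ^ 2 + C (4 * u)) (a := 3)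
    (b := W.a₂ - w) (c := 27) three_ne ?_ ?_ ?_ ?_
  · rw [show (27 : K) = 3 ^ 3 by norm_num]
    exact pow_ne_zero 3 three_ne
  · compute_degree
  · refine Polynomial.funext fun x => ?_
    simp only [WeierstrassCurve.rhs, hW.a₂, hW.a₄, hW.a₆, eval_mul, eval_add, eval_pow,
      eval_X, eval_C, eval_comp]
    simp only [c₄, negC₆] at hw hu
    linear_combination (9 * x + 3 * ((1 + d - d ^ 2) ^ 2 + 4 * (d ^ 2 - d ^ 3))) * hw + 2 * hu
  · rw [coeff_cubic_pow_eq hm hN hr, ← hpoly, hw, mul_pow 9]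
    linear_combination 27 ^ N * 9 ^ r * h

lemma exists_derivative_eq_rhs_pow {S : Type*} [Field S] {p m N r : ℕ} [Fact p.Prime]
    [CharP S p] (hm : p = 2 * m + 1) (hN : m = 3 * N + 2 * r) (hr : r ≤ 1) (two_ne : (2 : S) ≠ 0)
    (three_ne : (3 : S) ≠ 0) {W : WeierstrassCurve S} {d : S} (hW : W.IsTateSeven d)
    (h : c₄ d ^ r * (hassePoly d N).coeff N = 0) : ∃ g, derivative g = W.rhs ^ m := by
  have hdeg : (W.rhs ^ m).natDegree < 2 * p - 1 :=
    natDegree_pow_le.trans_lt (by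
      rw [WeierstrassCurve.natDegree_rhs]
      omega)
  refine exists_derivative_eq hdeg ?_
  set φ := algebraMap S (AlgebraicClosure S)
  have : CharP (AlgebraicClosure S) p := charP_of_injective_algebraMap φ.injective p
  rw [show p - 1 = 2 * m by omega]
  refine φ.injective ?_
  rw [map_zero, ← coeff_map, Polynomial.map_pow, ← WeierstrassCurve.rhs_map]
  refine coeff_rhs_pow_eq_zero hm hN hr ?_ ?_ (hW.map φ) ?_
  · simpa only [map_ofNat φ] using (map_ne_zero φ).2 two_ne
  · simpa only [map_ofNat φ] using (map_ne_zero φ).2 three_ne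
  · have hmap : (hassePoly d N).map φ = hassePoly (φ d) N := by
      simp only [hassePoly, Polynomial.map_pow, Polynomial.map_add, Polynomial.map_mul, map_X,
        map_C, ← map_negC₆, ← map_Δ, map_mul, map_neg, map_ofNat,
        Polynomial.map_neg, Polynomial.map_ofNat]
    rw [← hmap, coeff_map, ← map_c₄, ← map_pow, ← map_mul, h, map_zero]

end TateSeven

namespace TateSeven

/-- The Tate normal form for a point of order `7`, after completing the square. -/
def curve {R : Type*} [CommRing R] (d : R) : WeierstrassCurve R where
  a₁ := 0
  a₂ := (1 + d - d ^ 2) ^ 2 + 4 * (d ^ 2 - d ^ 3)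
  a₃ := 0
  a₄ := 8 * (1 + d - d ^ 2) * (d ^ 2 - d ^ 3)
  a₆ := 16 * (d ^ 2 - d ^ 3) ^ 2

lemma isTateSeven_curve {R : Type*} [CommRing R] (d : R) : (curve d).IsTateSeven d :=
  ⟨rfl, rfl, rfl, rfl, rfl⟩

variable {l : ℕ} [Fact l.Prime] {S : Type*} [Field S] [Algebra (ZMod l) S] {d : S}

lemma natCast_ne_zero {p : ℕ} (hp : p.Prime) (h : l ≠ p) : (p : S) ≠ 0 := by
  have : CharP S l := charP_of_injective_algebraMap (algebraMap (ZMod l) S).injective l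
  rw [Ne, CharP.cast_eq_zero_iff S l]
  exact mt (Nat.prime_dvd_prime_iff_eq Fact.out hp).1 h

lemma exists_of_aeval_H7_eq_zero (h2 : l ≠ 2) (h3 : l ≠ 3) (h7 : l ≠ 7)
    (hd : aeval d (H7 l) = 0) :
    (curve d).IsElliptic ∧ ∃ g, derivative g = (curve d).rhs ^ (l / 2) := by
  have : CharP S l := charP_of_injective_algebraMap (algebraMap (ZMod l) S).injective l
  have two_ne : (2 : S) ≠ 0 := by exact_mod_cast natCast_ne_zero Nat.prime_two h2
  have three_ne : (3 : S) ≠ 0 := by exact_mod_cast natCast_ne_zero Nat.prime_three h3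
  have seven_ne : (7 : S) ≠ 0 := by exact_mod_cast natCast_ne_zero (by norm_num) h7
  rw [aeval_H7] at hd
  constructor
  · refine ⟨IsUnit.mk0 _ ?_⟩
    rw [(isTateSeven_curve d).Δ_eq]
    refine mul_ne_zero ?_ (Δ_ne_zero seven_ne hd)
    rw [show (4096 : S) = 2 ^ 12 by norm_num]
    exact pow_ne_zero _ two_ne
  · have hl2 := (Fact.out : l.Prime).eq_two_or_odd
    have hl3 : l % 3 ≠ 0 := fun h =>
      h3 ((Nat.prime_dvd_prime_iff_eq Nat.prime_three Fact.out).1 (Nat.dvd_of_mod_eq_zero h)).symm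
    exact exists_derivative_eq_rhs_pow (by omega) (by split_ifs <;> omega) (by split_ifs <;> simp)
      two_ne three_ne (isTateSeven_curve d) hd

lemma mod_three_of_aeval_H7_eq_zero (h2 : l ≠ 2) (h3 : l ≠ 3) (h7 : l ≠ 7)
    (hd : aeval d (H7 l) = 0) (hd3 : d ^ 2 - d + 1 = 0) : l % 3 = 2 := by
  have : CharP S l := charP_of_injective_algebraMap (algebraMap (ZMod l) S).injective l
  have seven_ne : (7 : S) ≠ 0 := by exact_mod_cast natCast_ne_zero (by norm_num) h7
  have hl := (Fact.out : l.Prime).two_le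
  rw [aeval_H7] at hd
  have hΔ := Δ_ne_zero seven_ne hd
  have h4 : c₄ d = 0 := by rw [c₄, hd3, zero_mul]
  have h6 : negC₆ d ≠ 0 := by
    intro h6
    have := c₄_cube_sub d
    rw [h4, h6] at this
    have two_ne : (2 : S) ≠ 0 := by exact_mod_cast natCast_ne_zero Nat.prime_two h2
    have three_ne : (3 : S) ≠ 0 := by exact_mod_cast natCast_ne_zero Nat.prime_three h3
    refine mul_ne_zero (mul_ne_zero (pow_ne_zero 6 two_ne) (pow_ne_zero 3 three_ne)) hΔ ?_
    linear_combination -this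
  by_contra h
  rw [if_neg h, pow_zero, one_mul] at hd
  exact coeff_hassePoly_ne_zero (p := l) h4 (by split_ifs <;> omega) (by omega) h6 hd

lemma pow_of_aeval_H7_eq_zero [Finite S] (h2 : l ≠ 2) (h3 : l ≠ 3) (h7 : l ≠ 7)
    (hd : aeval d (H7 l) = 0) :
    (l % 7 = 1 ∨ l % 7 = 6 → d ^ l ^ 2 = d) ∧
    (l % 7 = 2 ∨ l % 7 = 5 → d ^ l ^ 2 * d = d - 1) ∧
    (l % 7 = 3 ∨ l % 7 = 4 → d ^ l ^ 2 * (d - 1) = -1) := by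
  classical
  obtain ⟨hE, g, hg⟩ := exists_of_aeval_H7_eq_zero h2 h3 h7 hd
  have hl2 := (Fact.out : l.Prime).eq_two_or_odd
  have : CharP S l := charP_of_injective_algebraMap (algebraMap (ZMod l) S).injective l
  set φ := algebraMap S (AlgebraicClosure S)
  have : CharP (AlgebraicClosure S) l := charP_of_injective_algebraMap φ.injective l
  have two_ne : (2 : AlgebraicClosure S) ≠ 0 := by
    have h2' : (2 : S) ≠ 0 := by exact_mod_cast natCast_ne_zero Nat.prime_two h2
    simpa only [map_ofNat φ] using (map_ne_zero φ).2 h2'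
  have hW := isTateSeven_curve d
  have key := (hW.map φ).pow_sq (W := (curve d).map φ) two_ne (p := l) fun P hP =>
    WeierstrassCurve.Affine.eq_zero_of_nsmul_eq_zero_of_isAlgebraic (W := curve d) hW.a₁ hW.a₃
      (show l = 2 * (l / 2) + 1 by omega) hg hP
  refine ⟨fun h => φ.injective ?_, fun h => φ.injective ?_, fun h => φ.injective ?_⟩
  · simpa using key.1 h
  · simpa using key.2.1 h
  · simpa using key.2.2 h

lemma even_of_aeval_H7_eq_zero [Finite S] (h2 : l ≠ 2) (h3 : l ≠ 3) (h7 : l ≠ 7)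
    (hd : aeval d (H7 l) = 0) {j : ℕ} (hj : Nat.card S = l ^ j) (hl : l ^ j % 7 = 1) : Even j := by
  have := Fintype.ofFinite S
  obtain ⟨hE, g, hg⟩ := exists_of_aeval_H7_eq_zero h2 h3 h7 hd
  have hlp : l.Prime := Fact.out
  have hl2 := hlp.eq_two_or_odd
  have : CharP S l := charP_of_injective_algebraMap (algebraMap (ZMod l) S).injective l
  obtain ⟨t, ht⟩ := WeierstrassCurve.Affine.isSquare_card_of_isTateSeven (isTateSeven_curve d)
    (show l = 2 * (l / 2) + 1 by omega) hg (by rw [← hj, Nat.card_eq_fintype_card]) hl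
  obtain ⟨i, -, rfl⟩ := (Nat.dvd_prime_pow hlp).1 ⟨t, ht⟩
  rw [← pow_add] at ht
  exact ⟨i, Nat.pow_right_injective hlp.two_le ht⟩

lemma pow_pow_six_of_aeval_H7_eq_zero [Finite S] (h2 : l ≠ 2) (h3 : l ≠ 3) (h7 : l ≠ 7)
    (hd : aeval d (H7 l) = 0) : d ^ l ^ 6 = d := by
  have : CharP S l := charP_of_injective_algebraMap (algebraMap (ZMod l) S).injective l
  have : ExpChar S l := .prime Fact.out
  have hl : l % 7 ≠ 0 := fun h => h7
    ((Nat.prime_dvd_prime_iff_eq (by norm_num) Fact.out).1 (Nat.dvd_of_mod_eq_zero h)).symm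
  obtain ⟨ha, hb, hc⟩ := pow_of_aeval_H7_eq_zero h2 h3 h7 hd
  rw [← iterateFrobenius_def] at ha hb hc
  have h6 : d ^ l ^ 6 = iterateFrobenius S l 2 (iterateFrobenius S l 2
      (iterateFrobenius S l 2 d)) := by
    simp only [iterateFrobenius_def, ← pow_mul, ← pow_add]
  rw [h6]
  generalize iterateFrobenius S l 2 = φ at *
  have hmod : (l % 7 = 1 ∨ l % 7 = 6) ∨ (l % 7 = 2 ∨ l % 7 = 5) ∨ (l % 7 = 3 ∨ l % 7 = 4) := by
    omega
  rcases hmod with h | h | h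
  · simp only [ha h]
  · have e₁ := hb h
    have e₂ := congrArg φ e₁
    have e₃ := congrArg φ e₂
    simp only [map_mul, map_sub, map_one] at e₂ e₃
    have e : φ (φ d) * (d - 1) = -1 := by linear_combination d * e₂ - (φ (φ d) - 1) * e₁
    linear_combination (φ (φ (φ d)) - 1) * e - (d - 1) * e₃
  · have e₁ := hc h
    have e₂ := congrArg φ e₁
    have e₃ := congrArg φ e₂
    simp only [map_mul, map_sub, map_one, map_neg] at e₂ e₃
    linear_combination (-d) * e₃ + φ (φ (φ d)) * (-(d - 1) * e₂ + φ (φ d) * e₁)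

lemma eq_zero_of_pow_sq_eq [Finite S] (h2 : l ≠ 2) (h3 : l ≠ 3) (h7 : l ≠ 7)
    (hd : aeval d (H7 l) = 0) (h1 : l % 7 ≠ 1) (h6 : l % 7 ≠ 6) (h : d ^ l ^ 2 = d) :
    d ^ 2 - d + 1 = 0 := by
  have hl : l % 7 ≠ 0 := fun h => h7
    ((Nat.prime_dvd_prime_iff_eq (by norm_num) Fact.out).1 (Nat.dvd_of_mod_eq_zero h)).symm
  obtain ⟨-, hb, hc⟩ := pow_of_aeval_H7_eq_zero h2 h3 h7 hd
  rw [h] at hb hc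
  by_cases hl' : l % 7 = 2 ∨ l % 7 = 5
  · linear_combination hb hl'
  · linear_combination hc (by omega)

lemma pow_ne_self_of_aeval_H7_eq_zero (h2 : l ≠ 2) (h3 : l ≠ 3) (h7 : l ≠ 7)
    (hd : aeval d (H7 l) = 0) (hd3 : d ^ 2 - d + 1 = 0) : d ^ l ≠ d := by
  intro h
  have three_ne : (3 : S) ≠ 0 := by exact_mod_cast natCast_ne_zero Nat.prime_three h3
  have hmod := mod_three_of_aeval_H7_eq_zero h2 h3 h7 hd hd3
  have hl2 := (Fact.out : l.Prime).eq_two_or_odd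
  have hcube : d ^ 3 = -1 := by linear_combination (d + 1) * hd3
  have hl : d ^ l = d ^ 5 := by
    rw [show l = 3 * (2 * (l / 6)) + 5 by omega, pow_add, pow_mul, hcube, pow_mul]
    norm_num
  rw [h] at hl
  apply three_ne
  linear_combination (2 * d + 3) * hd3 - (2 * d - 1) * (hl + d ^ 2 * hcube)

end TateSeven

/-- Degrees of the monic irreducible factors of `Ĥ_{7,l}(x)` over `𝔽_l`, for a prime
`l ∉ {2,3,7}`, according to the residue class of `l` mod 7. -/
theorem H7_irreducible_factor_degrees (l : ℕ) [Fact l.Prime]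
    (h2 : l ≠ 2) (h3 : l ≠ 3) (h7 : l ≠ 7)
    (f : Polynomial (ZMod l)) (hmonic : f.Monic) (hirr : Irreducible f)
    (hdvd : f ∣ H7 l) :
    (l % 7 = 1 → f.natDegree = 2) ∧
    (l % 7 = 6 → f.natDegree = 1 ∨ f.natDegree = 2) ∧
    (l % 7 = 2 ∨ l % 7 = 4 →
      f = X ^ 2 - X + 1 ∨ f.natDegree = 6) ∧
    (l % 7 = 3 ∨ l % 7 = 5 →
      f = X ^ 2 - X + 1 ∨ f.natDegree = 3 ∨ f.natDegree = 6) := by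
  have : Fact (Irreducible f) := ⟨hirr⟩
  set d := AdjoinRoot.root f
  have hzero : ∀ g : (ZMod l)[X], aeval d g = 0 ↔ f ∣ g := fun g => by
    rw [AdjoinRoot.aeval_eq, AdjoinRoot.mk_eq_zero]
  have hd : aeval d (H7 l) = 0 := (hzero _).2 hdvd
  have : Module.Finite (ZMod l) (AdjoinRoot f) := (AdjoinRoot.powerBasis hirr.ne_zero).finite
  have : Finite (AdjoinRoot f) := Module.finite_of_finite (ZMod l)
  have hcard : Nat.card (AdjoinRoot f) = l ^ f.natDegree := by
    rw [Module.natCard_eq_pow_finrank (K := ZMod l), Nat.card_zmod,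
      (AdjoinRoot.powerBasis hirr.ne_zero).finrank, AdjoinRoot.powerBasis_dim]
  have hdeg : ∀ n, n ≠ 0 → (f.natDegree ∣ n ↔ d ^ l ^ n = d) := by
    intro n hn
    rw [hirr.natDegree_dvd_iff_dvd_X_pow_card_pow_sub_X, Nat.card_zmod, ← hzero]
    simp [sub_eq_zero]
  have heven := TateSeven.even_of_aeval_H7_eq_zero h2 h3 h7 hd hcard
  have hpow := TateSeven.pow_of_aeval_H7_eq_zero h2 h3 h7 hd
  have hpos := hirr.natDegree_pos
  have hquad : l % 7 ≠ 1 → l % 7 ≠ 6 → f.natDegree ∣ 2 → f = X ^ 2 - X + 1 := by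
    intro h1 h6 h
    have hd3 := TateSeven.eq_zero_of_pow_sq_eq h2 h3 h7 hd h1 h6 ((hdeg 2 two_ne_zero).1 h)
    have hf : f ∣ X ^ 2 - X + 1 := (hzero _).1 (by simpa using hd3)
    have hmon : (X ^ 2 - X + 1 : (ZMod l)[X]).Monic := by monicity!
    have hndeg : (X ^ 2 - X + 1 : (ZMod l)[X]).natDegree = 2 := by compute_degree!
    rcases (Nat.dvd_prime Nat.prime_two).1 h with hone | htwo
    · have hl := (hdeg 1 one_ne_zero).1 (by rw [hone])
      have := TateSeven.pow_ne_self_of_aeval_H7_eq_zero h2 h3 h7 hd hd3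
      exact absurd (by simpa using hl) this
    · exact (eq_of_monic_of_dvd_of_natDegree_le hmonic hmon hf (by omega)).symm
  have hsix : f.natDegree ∣ 6 :=
    (hdeg 6 (by norm_num)).2 (TateSeven.pow_pow_six_of_aeval_H7_eq_zero h2 h3 h7 hd)
  have hsix' : f.natDegree = 1 ∨ f.natDegree = 2 ∨ f.natDegree = 3 ∨ f.natDegree = 6 := by
    have := Nat.le_of_dvd (by norm_num) hsix
    interval_cases f.natDegree <;> omega
  have hmod : ∀ j, l ^ j % 7 = (l % 7) ^ j % 7 := fun j => Nat.pow_mod l j 7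
  refine ⟨fun h => ?_, fun h => ?_, fun h => ?_, fun h => ?_⟩
  · have h2' := (hdeg 2 two_ne_zero).2 (hpow.1 (Or.inl h))
    rcases (Nat.dvd_prime Nat.prime_two).1 h2' with h1 | h1
    · rw [hmod, h, one_pow, h1] at heven
      simp at heven
    · exact h1
  · exact (Nat.dvd_prime Nat.prime_two).1 ((hdeg 2 two_ne_zero).2 (hpow.1 (Or.inr h)))
  · have hq := hquad (by omega) (by omega)
    rcases hsix' with h1 | h1 | h1 | h1
    · exact Or.inl (hq (by simp [h1]))
    · exact Or.inl (hq (by simp [h1]))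
    · rw [hmod, h1] at heven
      rcases h with h | h <;> rw [h] at heven <;> exact absurd (heven (by norm_num)) (by decide)
    · exact Or.inr h1
  · have hq := hquad (by omega) (by omega)
    rcases hsix' with h1 | h1 | h1 | h1
    · exact Or.inl (hq (by simp [h1]))
    · exact Or.inl (hq (by simp [h1]))
    · exact Or.inr (Or.inl h1)
    · exact Or.inr (Or.inr h1)
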